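/- arXiv:2008.12836 — 7 statements merged into one kernel-verified Lean document; each statement's English description precedes it below -/
import Mathlib

section
/- (Patching lemma.) Let (X,d) be a compact, K_D-doubling, K_P-uniformly perfect metric space with diam(X,d) = 1/2, equipped with a hyperbolic filling with parameters λ ≥ 32 and a ≥ 24·max(λ,K_P), let β, η₁ > 0, and let C : S → (0,∞) be (K_h,K_v)-gentle. Assume that for every k ≥ 1 and B ∈ S_k there is a function σ_B : S_{k+1} → [0,1/4) such that: (a) σ_B(B′) = 0 for every B′ ∈ S_{k+1} with B′ ∩ 3·B = ∅; (b) Σ_{i=1}^{N} σ_B(B_i) ≥ 1 for every path (B₁,…,B_N) ∈ Γ_{k+1}(B); (c) Σ_{B′ ∈ S_{k+1}} σ_B(B′)^β·C(B′) ≤ η₁·C(B). Define σ : S → [0,1/4) by σ(B′) := max{σ_A(B′) : A ∈ S_k} for B′ ∈ S_{k+1}, k ≥ 1, and σ ≡ 0 on S₀ ∪ S₁. Then σ satisfies (S1), and there exists a constant C₁ ≥ 1, depending only on K_D, K_h and λ, such that Σ_{B′ ∈ D_{k+1}(B)} σ(B′)^β·C(B′) ≤ C₁·η₁·C(B) for every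 k ≥ 0 and B ∈ S_k. -/
open Metric Set MeasureTheory Filter Topology
open scoped BigOperators ENNReal NNReal

noncomputable section

/-- A metric space `(X,d)` is `K`-doubling: every ball of radius `r` can be covered by at most
`K` balls of radius `r/2`. -/
def IsDoublingWith (X : Type*) [PseudoMetricSpace X] (K : ℝ) : Prop :=
  ∀ (x : X) (r : ℝ), 0 < r → ∃ t : Finset X, (t.card : ℝ) ≤ K ∧
    Metric.ball x r ⊆ ⋃ y ∈ t, Metric.ball y (r / 2)

/-- A metric space `(X,d)` is `K`-uniformly perfect: if `X ∖ B(x,r) ≠ ∅` then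
`B(x,r) ∖ B(x,r/K) ≠ ∅`. -/
def IsUniformlyPerfectWith (X : Type*) [PseudoMetricSpace X] (K : ℝ) : Prop :=
  ∀ (x : X) (r : ℝ), 0 < r → ((Metric.ball x r)ᶜ).Nonempty →
    (Metric.ball x r \ Metric.ball x (r / K)).Nonempty

/-- A hyperbolic filling of a compact metric space `(X,d)` (of diameter `1/2`) with vertical
parameter `a`: for each level `n`, a finite set `N n` of centers of balls of radius `2·a⁻ⁿ`
covering `X`, whose centers are `a⁻ⁿ`-separated, with `N 0` a singleton, together with a
parent assignment sending each center at level `n+1` to a nearest center at level `n`. -/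
structure HypFilling (X : Type*) [MetricSpace X] (a : ℝ) where
  N : ℕ → Finset X
  N0 : ∃ x₀ : X, N 0 = {x₀}
  sep : ∀ n : ℕ, ∀ x ∈ N n, ∀ y ∈ N n, x ≠ y → a ^ (-(n : ℤ)) ≤ dist x y
  cover : ∀ (n : ℕ) (y : X), ∃ x ∈ N n, dist y x < 2 * a ^ (-(n : ℤ))
  parent : ℕ → X → X
  parent_mem : ∀ n : ℕ, ∀ x ∈ N (n + 1), parent n x ∈ N n
  parent_nearest : ∀ n : ℕ, ∀ x ∈ N (n + 1), ∀ z ∈ N n, dist x (parent n x) ≤ dist x z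

namespace HypFilling

variable {X : Type*} [MetricSpace X] {a : ℝ}

/-- `anc F j n x` is the `j`-step ancestor (living at level `n - j`) of the vertex of the
filling with center `x` at level `n`; i.e. the genealogy of `(n,x)` is
`g(B)ᵢ = anc F (n-i) n x`. -/
def anc (F : HypFilling X a) : ℕ → ℕ → X → X
  | 0, _, x => x
  | j + 1, n, x => F.parent (n - (j + 1)) (anc F j n x)

/-- `π(B) = ∏_{i=0}^{n} ρ(g(B)ᵢ)` for a vertex `B = (n,x)` and weight function `ρ`. -/
def piW (F : HypFilling X a) (ρ : ℕ → X → ℝ) (n : ℕ) (x : X) : ℝ :=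
  ∏ j ∈ Finset.range (n + 1), ρ (n - j) (anc F j n x)

/-- `(n,x')` is a descendant of `(m,x)`, i.e. `x' ∈ D_n((m,x))`. -/
def Desc (F : HypFilling X a) (m : ℕ) (x : X) (n : ℕ) (x' : X) : Prop :=
  x' ∈ F.N n ∧ anc F (n - m) n x' = x

/-- Horizontal edge (with horizontal parameter `lam`) between the distinct level-`n` vertices
with centers `x` and `y`: the `lam`-dilates of the two balls intersect. -/
def Hor (F : HypFilling X a) (lam : ℝ) (n : ℕ) (x y : X) : Prop :=
  x ∈ F.N n ∧ y ∈ F.N n ∧ x ≠ y ∧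
    (Metric.ball x (lam * (2 * a ^ (-(n : ℤ)))) ∩
      Metric.ball y (lam * (2 * a ^ (-(n : ℤ))))).Nonempty

/-- Horizontal or vertical edge on the vertex set `⊔ₙ Sₙ` (a vertex is a pair (level, center)). -/
def Edge (F : HypFilling X a) (lam : ℝ) (v w : ℕ × X) : Prop :=
  (v.1 = w.1 ∧ F.Hor lam v.1 v.2 w.2) ∨
    (w.1 = v.1 + 1 ∧ w.2 ∈ F.N (v.1 + 1) ∧ F.parent v.1 w.2 = v.2) ∨
    (v.1 = w.1 + 1 ∧ v.2 ∈ F.N (w.1 + 1) ∧ F.parent w.1 v.2 = w.2)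

/-- Condition (H1): the weight function is bounded between two constants `0 < η₋ ≤ η₊ < 1`. -/
def H1 (F : HypFilling X a) (ρ : ℕ → X → ℝ) : Prop :=
  ∃ ηm ηp : ℝ, 0 < ηm ∧ ηm ≤ ηp ∧ ηp < 1 ∧
    ∀ n : ℕ, ∀ x ∈ F.N n, ηm ≤ ρ n x ∧ ρ n x ≤ ηp

/-- Condition (H2): `π` is comparable along horizontal edges. -/
def H2 (F : HypFilling X a) (lam : ℝ) (ρ : ℕ → X → ℝ) : Prop :=
  ∃ K₀ : ℝ, 1 ≤ K₀ ∧ ∀ (n : ℕ) (x y : X), F.Hor lam n x y →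
    F.piW ρ n x ≤ K₀ * F.piW ρ n y

/-- `z` is the center of a level-`j` vertex whose `α`-dilate contains both `x` and `y`. -/
def inC (F : HypFilling X a) (α : ℝ) (x y : X) (j : ℕ) (z : X) : Prop :=
  z ∈ F.N j ∧ dist x z < α * (2 * a ^ (-(j : ℤ))) ∧ dist y z < α * (2 * a ^ (-(j : ℤ)))

/-- `m_α(x,y)`: the maximal level `j` such that some level-`j` vertex has both `x` and `y`
in its `α`-dilate. -/
def mAlpha (F : HypFilling X a) (α : ℝ) (x y : X) : ℕ :=
  sSup {j : ℕ | ∃ z : X, F.inC α x y j z}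

/-- `π(c_α(x,y))`: the maximum of `π` over the level-`m_α(x,y)` vertices whose `α`-dilates
contain both `x` and `y`. -/
def piC (F : HypFilling X a) (ρ : ℕ → X → ℝ) (α : ℝ) (x y : X) : ℝ :=
  sSup ((fun z => F.piW ρ (F.mAlpha α x y) z) '' {z : X | F.inC α x y (F.mAlpha α x y) z})

/-- A path of vertices `p 0, …, p (k-1)` of the filling, joined consecutively by horizontal or
vertical edges, starting and ending at level `n`, from a ball containing `x` to a ball
containing `y`. -/
def IsPath (F : HypFilling X a) (lam : ℝ) (n k : ℕ) (p : ℕ → ℕ × X) (x y : X) : Prop :=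
  1 ≤ k ∧ (∀ i < k, (p i).2 ∈ F.N (p i).1) ∧
    (∀ i : ℕ, i + 1 < k → F.Edge lam (p i) (p (i + 1))) ∧
    (p 0).1 = n ∧ (p (k - 1)).1 = n ∧
    dist x (p 0).2 < 2 * a ^ (-(n : ℤ)) ∧ dist y (p (k - 1)).2 < 2 * a ^ (-(n : ℤ))

/-- Condition (H3) with visual parameter `α` and constant `K₁`. -/
def H3With (F : HypFilling X a) (lam : ℝ) (ρ : ℕ → X → ℝ) (α K₁ : ℝ) : Prop :=
  2 ≤ α ∧ α ≤ lam / 4 ∧ 1 ≤ K₁ ∧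
    ∀ x y : X, x ≠ y → ∃ n₀ : ℕ, ∀ n : ℕ, n₀ ≤ n →
      ∀ (k : ℕ) (p : ℕ → ℕ × X), F.IsPath lam n k p x y →
        K₁⁻¹ * F.piC ρ α x y ≤ ∑ i ∈ Finset.range k, F.piW ρ (p i).1 (p i).2

/-- Condition (H3). -/
def H3 (F : HypFilling X a) (lam : ℝ) (ρ : ℕ → X → ℝ) : Prop :=
  ∃ α K₁ : ℝ, F.H3With lam ρ α K₁

/-- `ρ` is `(β,C)`-compatible. -/
def Compatible (F : HypFilling X a) (β : ℝ) (C ρ : ℕ → X → ℝ) : Prop :=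
  ∃ K₂ : ℝ, 1 ≤ K₂ ∧ ∀ m : ℕ, ∀ x ∈ F.N m, ∀ n : ℕ, m < n →
    K₂⁻¹ * (F.piW ρ m x ^ β * C m x) ≤
        (∑ᶠ x' ∈ {x' : X | F.Desc m x n x'}, F.piW ρ n x' ^ β * C n x') ∧
      (∑ᶠ x' ∈ {x' : X | F.Desc m x n x'}, F.piW ρ n x' ^ β * C n x') ≤
        K₂ * (F.piW ρ m x ^ β * C m x)

/-- `C` is `(K_h,K_v)`-gentle: comparable (with constant `K_h`, resp. `K_v`) along horizontal,
resp. vertical, edges. -/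
def Gentle (F : HypFilling X a) (lam Kh Kv : ℝ) (C : ℕ → X → ℝ) : Prop :=
  (∀ (n : ℕ) (x y : X), F.Hor lam n x y → C n x ≤ Kh * C n y) ∧
    ∀ n : ℕ, ∀ x ∈ F.N (n + 1),
      C (n + 1) x ≤ Kv * C n (F.parent n x) ∧ C n (F.parent n x) ≤ Kv * C (n + 1) x

/-- The level-`(k+1)` vertex with center `x` is non-peripheral: all its horizontal neighbours
have the same parent. -/
def NonPeripheral (F : HypFilling X a) (lam : ℝ) (k : ℕ) (x : X) : Prop :=
  x ∈ F.N (k + 1) ∧ ∀ y : X, F.Hor lam (k + 1) x y → F.parent k y = F.parent k x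

/-- Condition (E): enhanced subadditivity of `C` over non-peripheral children. -/
def CondE (F : HypFilling X a) (lam : ℝ) (C : ℕ → X → ℝ) : Prop :=
  ∃ δ : ℝ, 0 < δ ∧ δ < 1 ∧ ∀ k : ℕ, 1 ≤ k → ∀ x ∈ F.N k,
    C k x ≤ (1 - δ) *
      ∑ᶠ x' ∈ {x' : X | F.parent k x' = x ∧ F.NonPeripheral lam k x'}, C (k + 1) x'

/-- The horizontal paths at level `k+1` crossing the annulus `2·B ∖ B` of a level-`k` ball `B`
with center `x`: the family `Γ_{k+1}(B)`. -/
def GammaPath (F : HypFilling X a) (lam : ℝ) (k : ℕ) (x : X) (m : ℕ) (p : ℕ → X) : Prop :=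
  2 ≤ m ∧ (∀ i < m, p i ∈ F.N (k + 1)) ∧
    (∀ i : ℕ, i + 1 < m → F.Hor lam (k + 1) (p i) (p (i + 1))) ∧
    dist (p 0) x < 2 * a ^ (-(k : ℤ)) ∧
    (∀ i < m - 1, dist (p i) x < 2 * (2 * a ^ (-(k : ℤ)))) ∧
    ¬ dist (p (m - 1)) x < 2 * (2 * a ^ (-(k : ℤ)))

/-- Condition (S1) for `σ`. -/
def S1 (F : HypFilling X a) (lam : ℝ) (σ : ℕ → X → ℝ) : Prop :=
  ∀ k : ℕ, ∀ x ∈ F.N k, ∀ (m : ℕ) (p : ℕ → X), F.GammaPath lam k x m p →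
    1 ≤ ∑ i ∈ Finset.range m, σ (k + 1) (p i)

/-- Condition (S2) for `σ` with constant `η₀`. -/
def S2 (F : HypFilling X a) (β η₀ : ℝ) (C σ : ℕ → X → ℝ) : Prop :=
  ∀ k : ℕ, ∀ x ∈ F.N k,
    (∑ᶠ x' ∈ {x' : X | x' ∈ F.N (k + 1) ∧ F.parent k x' = x},
        σ (k + 1) x' ^ β * C (k + 1) x') ≤ η₀ * C k x

end HypFilling

/-- Iterated doubling: a ball of radius `r` is covered by `K ^ n` balls of radius `r / 2 ^ n`. -/
theorem doubling_iterate {X : Type*} [PseudoMetricSpace X] {K : ℝ} (hK : 1 ≤ K)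
    (h : IsDoublingWith X K) (n : ℕ) :
    ∀ (x : X) (r : ℝ), 0 < r → ∃ t : Finset X, (t.card : ℝ) ≤ K ^ n ∧
      Metric.ball x r ⊆ ⋃ y ∈ t, Metric.ball y (r / 2 ^ n) := by
  classical
  induction n with
  | zero =>
    intro x r hr
    exact ⟨{x}, by simp, by simp⟩
  | succ n ih =>
    intro x r hr
    obtain ⟨t, htc, ht⟩ := ih x r hr
    have hr' : 0 < r / 2 ^ n := by positivity
    choose f hfc hf using fun y : X => h y (r / 2 ^ n) hr'
    refine ⟨t.biUnion f, ?_, ?_⟩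
    · calc ((t.biUnion f).card : ℝ) ≤ ((∑ y ∈ t, (f y).card : ℕ) : ℝ) := by
            exact_mod_cast Finset.card_biUnion_le
        _ = ∑ y ∈ t, ((f y).card : ℝ) := by push_cast; rfl
        _ ≤ ∑ _y ∈ t, K := Finset.sum_le_sum fun y _ => hfc y
        _ = t.card * K := by simp
        _ ≤ K ^ n * K := by gcongr
        _ = K ^ (n + 1) := by ring
    · intro z hz
      have h1 := ht hz
      simp only [Set.mem_iUnion, exists_prop] at h1
      obtain ⟨y, hy, hzy⟩ := h1
      have h2 := hf y hzy
      simp only [Set.mem_iUnion, exists_prop] at h2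
      obtain ⟨w, hw, hzw⟩ := h2
      simp only [Set.mem_iUnion, exists_prop]
      refine ⟨w, Finset.mem_biUnion.2 ⟨y, hy, hw⟩, ?_⟩
      have : r / 2 ^ (n + 1) = r / 2 ^ n / 2 := by rw [pow_succ, div_div]
      rw [this]
      exact hzw

/-- A `s`-separated finite set inside a ball of radius `9 s` has at most `K ^ 5` points. -/
theorem separated_card_le {X : Type*} [MetricSpace X] {K : ℝ} (hK : 1 ≤ K)
    (h : IsDoublingWith X K) (x : X) (s : ℝ) (hs : 0 < s) (T : Finset X)
    (hT : ∀ y ∈ T, dist y x < 9 * s)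
    (hsep : ∀ y ∈ T, ∀ z ∈ T, y ≠ z → s ≤ dist y z) : (T.card : ℝ) ≤ K ^ 5 := by
  classical
  obtain ⟨t, htc, ht⟩ := doubling_iterate hK h 5 x (9 * s) (by positivity)
  have key : ∀ y ∈ T, ∃ w ∈ t, dist y w < 9 * s / 2 ^ 5 := by
    intro y hy
    have h1 := ht (Metric.mem_ball.2 (hT y hy))
    simp only [Set.mem_iUnion, exists_prop] at h1
    exact h1
  choose! g hg hgd using key
  have hcard : T.card ≤ t.card := by
    refine Finset.card_le_card_of_injOn g (fun y hy => hg y hy) ?_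
    intro y hy z hz hyz
    by_contra hne
    have h1 := hsep y hy z hz hne
    have h2 := hgd y hy
    have h3 := hgd z hz
    rw [← hyz] at h3
    have h4 := dist_triangle_right y z (g y)
    norm_num at h2 h3
    linarith
  exact le_trans (by exact_mod_cast hcard) htc

/-- Lemma 3.12 (Patching lemma): given, for each level-`k` vertex `B` (k ≥ 1), a local
function `σ_B : S_{k+1} → [0,1/4)` supported on the balls meeting `3·B`, summing to at least
`1` along every path of `Γ_{k+1}(B)`, and with `Σ_{B'} σ_B(B')^β C(B') ≤ η₁ C(B)`, the
pointwise maximum `σ(B') = max_{A ∈ S_k} σ_A(B')` (set to `0` on `S₀ ∪ S₁`) satisfies (S1),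
and `Σ_{B' ∈ D_{k+1}(B)} σ(B')^β C(B') ≤ C₁ η₁ C(B)` for a constant `C₁ ≥ 1` depending only
on `K_D`, `K_h` and `λ`. -/
theorem patching_lemma (KD Kh lam : ℝ) (hKD : 1 ≤ KD) (hKh : 1 ≤ Kh) (hlam : 32 ≤ lam) :
    ∃ C₁ : ℝ, 1 ≤ C₁ ∧
      ∀ (X : Type) [MetricSpace X] [CompactSpace X],
        ∀ (KP a Kv β η₁ : ℝ) (F : HypFilling X a) (C : ℕ → X → ℝ)
          (σfam : ℕ → X → X → ℝ),
          1 < KP → 24 * max lam KP ≤ a → 1 ≤ Kv → 0 < β → 0 < η₁ →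
          Metric.diam (Set.univ : Set X) = 1 / 2 →
          IsDoublingWith X KD → IsUniformlyPerfectWith X KP →
          (∀ n : ℕ, ∀ x ∈ F.N n, 0 < C n x) →
          F.Gentle lam Kh Kv C →
          (∀ k : ℕ, 1 ≤ k → ∀ A ∈ F.N k,
            (∀ x' ∈ F.N (k + 1), 0 ≤ σfam k A x' ∧ σfam k A x' < 1 / 4) ∧
            (∀ x' ∈ F.N (k + 1),
              Metric.ball x' (2 * a ^ (-((k : ℤ) + 1))) ∩
                  Metric.ball A (3 * (2 * a ^ (-(k : ℤ)))) = ∅ → σfam k A x' = 0) ∧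
            (∀ (m : ℕ) (p : ℕ → X), F.GammaPath lam k A m p →
              1 ≤ ∑ i ∈ Finset.range m, σfam k A (p i)) ∧
            (∑ x' ∈ F.N (k + 1), σfam k A x' ^ β * C (k + 1) x') ≤ η₁ * C k A) →
          ∀ σ : ℕ → X → ℝ,
            (∀ x' : X, σ 0 x' = 0) →
            (∀ x' : X, σ 1 x' = 0) →
            (∀ k : ℕ, 1 ≤ k → ∀ x' ∈ F.N (k + 1),
              σ (k + 1) x' = sSup {t : ℝ | ∃ A ∈ F.N k, t = σfam k A x'}) →
            F.S1 lam σ ∧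
              ∀ k : ℕ, ∀ x ∈ F.N k,
                (∑ᶠ x' ∈ {x' : X | x' ∈ F.N (k + 1) ∧ F.parent k x' = x},
                    σ (k + 1) x' ^ β * C (k + 1) x') ≤ C₁ * η₁ * C k x := by
  classical
  refine ⟨KD ^ 5 * Kh, one_le_mul_of_one_le_of_one_le (one_le_pow₀ hKD) hKh, ?_⟩
  intro X _ _ KP a Kv β η₁ F C σfam hKP ha hKv hβ hη hdiam hD _ hC hG hfam σ hσ0 hσ1 hσ
  have ha1 : 768 ≤ a := by
    have := le_max_left lam KP
    linarith
  have ha0 : 0 < a := by linarith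
  have hbdd : ∀ (k : ℕ) (x' : X), BddAbove {t : ℝ | ∃ A ∈ F.N k, t = σfam k A x'} := by
    intro k x'
    have : {t : ℝ | ∃ A ∈ F.N k, t = σfam k A x'} =
        ((F.N k).image fun A => σfam k A x' : Finset ℝ) := by
      ext t
      simp [eq_comm]
    rw [this]
    exact Finset.bddAbove _
  have hatt : ∀ (k : ℕ), 1 ≤ k → ∀ x ∈ F.N k, ∀ x' ∈ F.N (k + 1),
      ∃ A ∈ F.N k, σ (k + 1) x' = σfam k A x' := by
    intro k hk x hx x' hx'
    have hfin : {t : ℝ | ∃ A ∈ F.N k, t = σfam k A x'} =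
        ((F.N k).image fun A => σfam k A x' : Finset ℝ) := by
      ext t
      simp [eq_comm]
    have hne : {t : ℝ | ∃ A ∈ F.N k, t = σfam k A x'}.Nonempty := ⟨_, x, hx, rfl⟩
    have hmem := hne.csSup_mem (by rw [hfin]; exact Finset.finite_toSet _)
    rw [hσ k hk x' hx']
    exact hmem
  constructor
  · intro k x hx m p hp
    rcases Nat.eq_zero_or_pos k with rfl | hk
    · exfalso
      apply hp.2.2.2.2.2
      have h1 : dist (p (m - 1)) x ≤ Metric.diam (Set.univ : Set X) :=
        Metric.dist_le_diam_of_mem isCompact_univ.isBounded (Set.mem_univ _) (Set.mem_univ _)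
      rw [hdiam] at h1
      norm_num
      linarith
    · refine le_trans ((hfam k hk x hx).2.2.1 m p hp) (Finset.sum_le_sum ?_)
      intro i hi
      rw [hσ k hk (p i) (hp.2.1 i (Finset.mem_range.1 hi))]
      exact le_csSup (hbdd k _) ⟨x, hx, rfl⟩
  · intro k x hx
    have hCx := hC k x hx
    rcases Nat.eq_zero_or_pos k with rfl | hk
    · have hz : (∑ᶠ x' ∈ {x' : X | x' ∈ F.N (0 + 1) ∧ F.parent 0 x' = x},
          σ (0 + 1) x' ^ β * C (0 + 1) x') = 0 := by
        apply finsum_mem_eq_zero_of_forall_eq_zero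
        intro x' _
        rw [zero_add, hσ1, Real.zero_rpow hβ.ne', zero_mul]
      rw [hz]
      positivity
    · have hset : {x' : X | x' ∈ F.N (k + 1) ∧ F.parent k x' = x} =
          ((F.N (k + 1)).filter fun x' => F.parent k x' = x : Finset X) := by
        ext; simp
      rw [hset, finsum_mem_coe_finset]
      set s : ℝ := a ^ (-(k : ℤ)) with hs
      have hs0 : 0 < s := zpow_pos ha0 _
      have hs1 : 768 * a ^ (-((k : ℤ) + 1)) ≤ s := by
        have h1 : s = a * a ^ (-((k : ℤ) + 1)) := by
          rw [hs, ← zpow_one_add₀ ha0.ne']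
          congr 1
          ring
        rw [h1]
        exact mul_le_mul_of_nonneg_right ha1 (zpow_pos ha0 _).le
      have hs2 : 0 < a ^ (-((k : ℤ) + 1)) := zpow_pos ha0 _
      set T := (F.N k).filter fun A => dist A x < 9 * s with hT
      have hTcard : (T.card : ℝ) ≤ KD ^ 5 := by
        refine separated_card_le hKD hD x s hs0 T (fun y hy => (Finset.mem_filter.1 hy).2) ?_
        intro y hy z hz hne
        exact F.sep k y (Finset.mem_filter.1 hy).1 z (Finset.mem_filter.1 hz).1 hne
      have hTC : ∀ A ∈ T, C k A ≤ Kh * C k x := by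
        intro A hA
        obtain ⟨hAN, hAd⟩ := Finset.mem_filter.1 hA
        by_cases hAx : A = x
        · subst hAx
          exact le_mul_of_one_le_left hCx.le hKh
        · refine hG.1 k A x ⟨hAN, hx, hAx, A, ?_, ?_⟩
          · apply Metric.mem_ball_self
            positivity
          · rw [Metric.mem_ball]
            have : 32 * (2 * s) ≤ lam * (2 * s) := by gcongr
            linarith
      have hnn : ∀ A ∈ F.N k, ∀ x' ∈ F.N (k + 1), 0 ≤ σfam k A x' ^ β * C (k + 1) x' := by
        intro A hA x' hx'
        exact mul_nonneg (Real.rpow_nonneg ((hfam k hk A hA).1 x' hx').1 _)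
          (hC _ _ hx').le
      have hpt : ∀ x' ∈ (F.N (k + 1)).filter fun x' => F.parent k x' = x,
          σ (k + 1) x' ^ β * C (k + 1) x' ≤ ∑ A ∈ T, σfam k A x' ^ β * C (k + 1) x' := by
        intro x' hx'
        obtain ⟨hxN, hpar⟩ := Finset.mem_filter.1 hx'
        have hnnT : ∀ A ∈ T, 0 ≤ σfam k A x' ^ β * C (k + 1) x' :=
          fun A hA => hnn A (Finset.mem_filter.1 hA).1 x' hxN
        obtain ⟨A, hA, hAe⟩ := hatt k hk x hx x' hxN
        rw [hAe]
        by_cases h0 : σfam k A x' = 0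
        · rw [h0, Real.zero_rpow hβ.ne', zero_mul]
          exact Finset.sum_nonneg hnnT
        · refine Finset.single_le_sum (f := fun A => σfam k A x' ^ β * C (k + 1) x') hnnT ?_
          refine Finset.mem_filter.2 ⟨hA, ?_⟩
          have hint := mt ((hfam k hk A hA).2.1 x' hxN) h0
          obtain ⟨z, hz1, hz2⟩ := Set.nonempty_iff_ne_empty.2 hint
          rw [Metric.mem_ball] at hz1 hz2
          obtain ⟨w, hw, hwd⟩ := F.cover k x'
          have h3 := F.parent_nearest k x' hxN w hw
          rw [hpar] at h3
          have h4 := dist_triangle_left A x z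
          have h5 := dist_triangle z x' x
          linarith
      calc ∑ x' ∈ (F.N (k + 1)).filter fun x' => F.parent k x' = x,
              σ (k + 1) x' ^ β * C (k + 1) x'
          ≤ ∑ x' ∈ (F.N (k + 1)).filter fun x' => F.parent k x' = x,
              ∑ A ∈ T, σfam k A x' ^ β * C (k + 1) x' := Finset.sum_le_sum hpt
        _ ≤ ∑ x' ∈ F.N (k + 1), ∑ A ∈ T, σfam k A x' ^ β * C (k + 1) x' := by
            refine Finset.sum_le_sum_of_subset_of_nonneg (Finset.filter_subset _ _) ?_
            intro x' hx' _
            exact Finset.sum_nonneg fun A hA => hnn A (Finset.mem_filter.1 hA).1 x' hx'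
        _ = ∑ A ∈ T, ∑ x' ∈ F.N (k + 1), σfam k A x' ^ β * C (k + 1) x' := Finset.sum_comm
        _ ≤ ∑ A ∈ T, η₁ * (Kh * C k x) := by
            refine Finset.sum_le_sum fun A hA => ?_
            refine le_trans (hfam k hk A (Finset.mem_filter.1 hA).1).2.2.2 ?_
            exact mul_le_mul_of_nonneg_left (hTC A hA) hη.le
        _ = T.card * (η₁ * (Kh * C k x)) := by simp
        _ ≤ KD ^ 5 * (η₁ * (Kh * C k x)) := by gcongr
        _ = KD ^ 5 * Kh * η₁ * C k x := by ring
end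
end

section
/- Let G = (V,E) be a graph in which every vertex has degree at most D, let C : V → (0,∞) satisfy K^{-1} ≤ C(z)/C(z′) ≤ K whenever {z,z′} ∈ E, let β > 0, let Γ be a family of finite paths in G, and let τ : V → (0,∞) satisfy Σ_{i=1}^{N-1} τ(z_i) ≥ 1 for every path (z₁,…,z_N) ∈ Γ. Define τ̃(x) := 2·max{τ(y) : y ∈ V₂(x)}, where V₂(x) is the set of vertices at graph distance at most 2 from x, and τ̃*(x) := min{τ̃(y) : {x,y} ∈ E}. Then: (i) Σ_{i=1}^{N-1} min(τ̃*(z_i), τ̃*(z_{i+1})) ≥ 1 for every path (z₁,…,z_N) ∈ Γ; (ii) Σ_{z∈V} τ̃(z)^β·C(z) ≤ 2^β·(1+D+D²)·K²·Σ_{z∈V} τ(z)^β·C(z), where the sums are taken in [0,∞]. -/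
open scoped BigOperators ENNReal

noncomputable section

/-- `V₂(x)`: the set of vertices of the graph `G` at graph distance at most 2 from `x`. -/
def ballTwo {V : Type*} (G : SimpleGraph V) (x : V) : Set V :=
  {y | y = x ∨ G.Adj x y ∨ ∃ z, G.Adj x z ∧ G.Adj z y}

/-- `τ̃(x) := 2·max{τ(y) : y ∈ V₂(x)}`. -/
noncomputable def ttil {V : Type*} (G : SimpleGraph V) (τ : V → ℝ) (x : V) : ℝ :=
  2 * sSup (τ '' ballTwo G x)

/-- `τ̃*(x) := min{τ̃(y) : y adjacent to x}`. -/
noncomputable def tstar {V : Type*} (G : SimpleGraph V) (τ : V → ℝ) (x : V) : ℝ :=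
  sInf (ttil G τ '' {y | G.Adj x y})

theorem aux_ball_finset {V : Type} (G : SimpleGraph V) (D : ℕ)
    (hdeg : ∀ x : V, ∃ s : Finset V, (∀ y : V, G.Adj x y → y ∈ s) ∧ s.card ≤ D) (x : V) :
    ∃ B : Finset V, (∀ y ∈ ballTwo G x, y ∈ B) ∧ B.card ≤ 1 + D + D ^ 2 := by
  classical
  choose s hs hc using hdeg
  refine ⟨{x} ∪ s x ∪ (s x).biUnion s, ?_, ?_⟩
  · intro y hy
    simp only [Finset.mem_union, Finset.mem_singleton, Finset.mem_biUnion]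
    rcases hy with h | h | ⟨z, h1, h2⟩
    · exact Or.inl (Or.inl h)
    · exact Or.inl (Or.inr (hs _ _ h))
    · exact Or.inr ⟨z, hs _ _ h1, hs _ _ h2⟩
  · have h1 := Finset.card_union_le ({x} ∪ s x) ((s x).biUnion s)
    have h2 := Finset.card_union_le {x} (s x)
    have h3 := Finset.card_biUnion_le_card_mul (s x) s D (fun a _ => hc a)
    have h4 : (s x).card * D ≤ D * D := Nat.mul_le_mul_right _ (hc x)
    have h5 := hc x
    rw [Finset.card_singleton] at h2
    nlinarith

theorem aux_ball_symm {V : Type} (G : SimpleGraph V) {x y : V} (h : y ∈ ballTwo G x) :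
    x ∈ ballTwo G y := by
  rcases h with h | h | ⟨z, h1, h2⟩
  · exact Or.inl h.symm
  · exact Or.inr (Or.inl h.symm)
  · exact Or.inr (Or.inr ⟨z, h2.symm, h1.symm⟩)

theorem aux_ball_image_finite {V : Type} (G : SimpleGraph V) (D : ℕ)
    (hdeg : ∀ x : V, ∃ s : Finset V, (∀ y : V, G.Adj x y → y ∈ s) ∧ s.card ≤ D)
    (τ : V → ℝ) (x : V) : (τ '' ballTwo G x).Finite := by
  obtain ⟨B, hB, -⟩ := aux_ball_finset G D hdeg x
  exact (B.finite_toSet.subset hB).image τ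

theorem aux_le_tstar {V : Type} (G : SimpleGraph V) (D : ℕ)
    (hdeg : ∀ x : V, ∃ s : Finset V, (∀ y : V, G.Adj x y → y ∈ s) ∧ s.card ≤ D)
    (τ : V → ℝ) (hτ : ∀ v : V, 0 < τ v) (x w : V) (hne : ∃ y, G.Adj x y)
    (h : ∀ y, G.Adj x y → w ∈ ballTwo G y) : τ w ≤ tstar G τ x := by
  obtain ⟨y0, hy0⟩ := hne
  refine le_csInf ⟨_, y0, hy0, rfl⟩ ?_
  rintro _ ⟨y, hy, rfl⟩
  have h1 : τ w ≤ sSup (τ '' ballTwo G y) :=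
    le_csSup (aux_ball_image_finite G D hdeg τ y).bddAbove ⟨w, h y hy, rfl⟩
  have h2 := hτ w
  unfold ttil
  linarith

theorem aux_ball_gentle {V : Type} (G : SimpleGraph V) (K : ℝ) (C : V → ℝ)
    (hC : ∀ v : V, 0 < C v) (hK : 1 ≤ K)
    (hgentle : ∀ x y : V, G.Adj x y → C x ≤ K * C y) {x y : V} (h : y ∈ ballTwo G x) :
    C x ≤ K ^ 2 * C y := by
  have hy := hC y
  have hKK : K ≤ K ^ 2 := by nlinarith
  rcases h with h | h | ⟨z, h1, h2⟩
  · subst h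
    nlinarith
  · exact (hgentle _ _ h).trans (mul_le_mul_of_nonneg_right hKK hy.le)
  · calc C x ≤ K * C z := hgentle _ _ h1
      _ ≤ K * (K * C y) := mul_le_mul_of_nonneg_left (hgentle _ _ h2) (by linarith)
      _ = K ^ 2 * C y := by ring

/-- Lemma 3.13 (cf. Carrasco Piaggo, Lemma 2.14): in a graph of maximal degree at most `D`,
with `C : V → (0,∞)` `K`-gentle along edges, if `τ > 0` sums to at least `1` along
every path in the family `Γ`, then `τ̃(x) = 2·max_{V₂(x)} τ` satisfies
`Σᵢ min(τ̃*(zᵢ), τ̃*(zᵢ₊₁)) ≥ 1` along every path of `Γ` and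
`Σ_V τ̃^β C ≤ 2^β (1 + D + D²) K² Σ_V τ^β C` (sums taken in `[0,∞]`). -/
theorem graph_weight_smoothing
    (V : Type) (G : SimpleGraph V) (D : ℕ) (K β : ℝ)
    (hdeg : ∀ x : V, ∃ s : Finset V, (∀ y : V, G.Adj x y → y ∈ s) ∧ s.card ≤ D)
    (C : V → ℝ) (hC : ∀ v : V, 0 < C v) (hK : 1 ≤ K)
    (hgentle : ∀ x y : V, G.Adj x y → C x ≤ K * C y)
    (hβ : 0 < β)
    (Γ : Set (ℕ × (ℕ → V)))
    (hΓ : ∀ p ∈ Γ, ∀ i : ℕ, i + 1 < p.1 → G.Adj (p.2 i) (p.2 (i + 1)))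
    (τ : V → ℝ) (hτ : ∀ v : V, 0 < τ v)
    (hadm : ∀ p ∈ Γ, 1 ≤ ∑ i ∈ Finset.range (p.1 - 1), τ (p.2 i)) :
    (∀ p ∈ Γ, 1 ≤ ∑ i ∈ Finset.range (p.1 - 1),
        min (tstar G τ (p.2 i)) (tstar G τ (p.2 (i + 1)))) ∧
      (∑' v : V, ENNReal.ofReal (ttil G τ v ^ β * C v)) ≤
        ENNReal.ofReal ((2 : ℝ) ^ β * (1 + (D : ℝ) + (D : ℝ) ^ 2) * K ^ 2) *
          ∑' v : V, ENNReal.ofReal (τ v ^ β * C v) := by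
  classical
  constructor
  · intro p hp
    refine (hadm p hp).trans (Finset.sum_le_sum fun i hi => ?_)
    have hi' : i + 1 < p.1 := by
      have := Finset.mem_range.1 hi
      omega
    have hadj := hΓ p hp i hi'
    refine le_min ?_ ?_
    · exact aux_le_tstar G D hdeg τ hτ _ _ ⟨_, hadj⟩ fun y hy => Or.inr (Or.inl hy.symm)
    · exact aux_le_tstar G D hdeg τ hτ _ _ ⟨_, hadj.symm⟩ fun y hy =>
        Or.inr (Or.inr ⟨_, hy.symm, hadj.symm⟩)
  · set f : V → ℝ≥0∞ := fun v => ENNReal.ofReal (τ v ^ β * C v) with hf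
    have hc0 : (0 : ℝ) ≤ 2 ^ β * K ^ 2 := by positivity
    have key : ∀ v, ENNReal.ofReal (ttil G τ v ^ β * C v) ≤
        ENNReal.ofReal (2 ^ β * K ^ 2) * ∑' y, (if y ∈ ballTwo G v then f y else 0) := by
      intro v
      have hne : (τ '' ballTwo G v).Nonempty := ⟨_, v, Or.inl rfl, rfl⟩
      obtain ⟨y, hy, hye⟩ := hne.csSup_mem (aux_ball_image_finite G D hdeg τ v)
      have h1 : ENNReal.ofReal (ttil G τ v ^ β * C v) ≤ ENNReal.ofReal (2 ^ β * K ^ 2) * f y := by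
        rw [hf, ← ENNReal.ofReal_mul hc0]
        apply ENNReal.ofReal_le_ofReal
        unfold ttil
        rw [← hye, Real.mul_rpow (by norm_num) (hτ y).le]
        have h2 := aux_ball_gentle G K C hC hK hgentle hy
        have h3 : 0 ≤ (2 : ℝ) ^ β * τ y ^ β :=
          mul_nonneg (by positivity) (Real.rpow_nonneg (hτ y).le _)
        calc (2 : ℝ) ^ β * τ y ^ β * C v ≤ (2 : ℝ) ^ β * τ y ^ β * (K ^ 2 * C y) :=
              mul_le_mul_of_nonneg_left h2 h3
          _ = _ := by ring
      refine h1.trans (mul_le_mul_right ?_ _)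
      have h4 := ENNReal.le_tsum (f := fun y => if y ∈ ballTwo G v then f y else 0) y
      simpa only [if_pos hy] using h4
    have cnt : ∀ y, ∑' v, (if y ∈ ballTwo G v then f y else 0) ≤
        ENNReal.ofReal (1 + (D : ℝ) + (D : ℝ) ^ 2) * f y := by
      intro y
      obtain ⟨B, hB, hcard⟩ := aux_ball_finset G D hdeg y
      rw [tsum_eq_sum (s := B) (fun v hv => if_neg fun h => hv (hB v (aux_ball_symm G h)))]
      have e : ENNReal.ofReal (1 + (D : ℝ) + (D : ℝ) ^ 2) = ((1 + D + D ^ 2 : ℕ) : ℝ≥0∞) := by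
        rw [← ENNReal.ofReal_natCast]
        push_cast
        rfl
      calc ∑ v ∈ B, (if y ∈ ballTwo G v then f y else 0) ≤ ∑ v ∈ B, f y := by
            refine Finset.sum_le_sum fun v _ => ?_
            split_ifs
            · exact le_rfl
            · exact zero_le
        _ = (B.card : ℝ≥0∞) * f y := by rw [Finset.sum_const, nsmul_eq_mul]
        _ ≤ _ := by
            rw [e]
            gcongr
    calc (∑' v : V, ENNReal.ofReal (ttil G τ v ^ β * C v))
        ≤ ∑' v, ENNReal.ofReal (2 ^ β * K ^ 2) * ∑' y, (if y ∈ ballTwo G v then f y else 0) :=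
          ENNReal.tsum_le_tsum key
      _ = ENNReal.ofReal (2 ^ β * K ^ 2) * ∑' y, ∑' v, (if y ∈ ballTwo G v then f y else 0) := by
          rw [ENNReal.tsum_mul_left, ENNReal.tsum_comm]
      _ ≤ ENNReal.ofReal (2 ^ β * K ^ 2) *
            ∑' y, ENNReal.ofReal (1 + (D : ℝ) + (D : ℝ) ^ 2) * f y :=
          mul_le_mul_right (ENNReal.tsum_le_tsum cnt) _
      _ = _ := by
          rw [ENNReal.tsum_mul_left, ← mul_assoc, ← ENNReal.ofReal_mul hc0]
          congr 2
          ring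
end
end

section
/- Let (X,d) be a compact, K_D-doubling, K_P-uniformly perfect metric space with diam(X,d) = 1/2, equipped with a hyperbolic filling with parameters λ ≥ 32 and a ≥ 24·max(λ,K_P), and let β > 0. Let ρ : S → (0,1) satisfy (H1) and (H2), let C : S → (0,∞) be (K_h,K_v)-gentle, and assume ρ is (β,C)-compatible. For n ≥ 0 set μ_n := Σ_{B ∈ S_n} π(B)^β·C(B)·δ_{x_B}, where δ_{x_B} is the Dirac measure at the center x_B, and let μ be a subsequential weak-* limit of (μ_n) (i.e., along some subsequence, ∫f dμ_{n_j} → ∫f dμ for every continuous f : X → ℝ). Then there exists C₁ > 1 such that for every x ∈ X, every 0 < r ≤ diam(X,d)/2 and every B ∈ A_S(B(x,r)): C₁^{-1}·π(B)^β·C(B) ≤ μ(B(x,r)) ≤ C₁·π(B)^β·C(B). Moreover, μ satisfies volume doubling (VD) on (X,d). -/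
open Metric Set MeasureTheory Filter Topology
open scoped BigOperators ENNReal NNReal

noncomputable section

/-- The discrete approximating measures `μₙ := Σ_{B ∈ Sₙ} π(B)^β C(B) δ_{x_B}`. -/
noncomputable def seqMeas {X : Type*} [MetricSpace X] [MeasurableSpace X] {a : ℝ}
    (F : HypFilling X a) (ρ C : ℕ → X → ℝ) (β : ℝ) (n : ℕ) : Measure X :=
  ∑ x ∈ F.N n, ENNReal.ofReal (F.piW ρ n x ^ β * C n x) • MeasureTheory.Measure.dirac x

namespace HypFilling
variable {X : Type*} [MetricSpace X] {a : ℝ}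

lemma e_pos (ha : 768 ≤ a) (n : ℕ) : 0 < a ^ (-(n : ℤ)) := by
  have : 0 < a := by linarith
  positivity

lemma e_succ (ha : 768 ≤ a) (n : ℕ) : 768 * a ^ (-((n + 1 : ℕ) : ℤ)) ≤ a ^ (-(n : ℤ)) := by
  have h0 : 0 < a := by linarith
  have h : a ^ (-(n : ℤ)) = a * a ^ (-((n + 1 : ℕ) : ℤ)) := by
    rw [← zpow_one_add₀ h0.ne']
    congr 1
    push_cast
    ring
  rw [h]
  exact mul_le_mul_of_nonneg_right ha (e_pos ha _).le

lemma anc_mem_dist (F : HypFilling X a) (ha : 768 ≤ a) (n : ℕ) (x : X) (hx : x ∈ F.N n) (j : ℕ) :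
    j ≤ n → F.anc j n x ∈ F.N (n - j) ∧
      dist x (F.anc j n x) ≤ 3 * a ^ (-((n - j : ℕ) : ℤ)) := by
  induction j with
  | zero =>
    intro _
    refine ⟨hx, ?_⟩
    have := e_pos ha (n - 0)
    simp only [anc, dist_self]
    linarith
  | succ j ih =>
    intro hj
    obtain ⟨h1, h2⟩ := ih (by omega)
    have hk : n - j = (n - (j + 1)) + 1 := by omega
    rw [hk] at h1 h2
    set k := n - (j + 1) with hkdef
    have hp : F.anc (j + 1) n x = F.parent k (F.anc j n x) := rfl
    rw [hp]
    refine ⟨F.parent_mem _ _ h1, ?_⟩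
    obtain ⟨z, hz, hd⟩ := F.cover k (F.anc j n x)
    have h3 := F.parent_nearest k _ h1 z hz
    have h4 := dist_triangle x (F.anc j n x) (F.parent k (F.anc j n x))
    have h5 := e_succ ha k
    have h6 := e_pos ha (k + 1)
    linarith

lemma anc_parent (F : HypFilling X a) (n : ℕ) (x : X) (j : ℕ) :
    F.anc j n (F.parent n x) = F.anc (j + 1) (n + 1) x := by
  induction j with
  | zero => simp [anc]
  | succ j ih =>
    have h1 : F.anc (j + 1) n (F.parent n x)
      = F.parent (n - (j + 1)) (F.anc j n (F.parent n x)) := rfl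
    have h2 : F.anc (j + 1 + 1) (n + 1) x
      = F.parent (n + 1 - (j + 1 + 1)) (F.anc (j + 1) (n + 1) x) := rfl
    rw [h1, h2, ih]
    congr 1
    omega

lemma piW_succ (F : HypFilling X a) (ρ : ℕ → X → ℝ) (n : ℕ) (x : X) :
    F.piW ρ (n + 1) x = F.piW ρ n (F.parent n x) * ρ (n + 1) x := by
  unfold piW
  rw [Finset.prod_range_succ']
  congr 1
  apply Finset.prod_congr rfl
  intro j _
  rw [anc_parent]
  congr 1
  omega

lemma piW_pos (F : HypFilling X a) (ha : 768 ≤ a) (ρ : ℕ → X → ℝ)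
    (hρ : ∀ n : ℕ, ∀ x ∈ F.N n, 0 < ρ n x ∧ ρ n x < 1) (n : ℕ) (x : X) (hx : x ∈ F.N n) :
    0 < F.piW ρ n x := by
  unfold piW
  apply Finset.prod_pos
  intro j hj
  have := Finset.mem_range.1 hj
  exact (hρ _ _ (F.anc_mem_dist ha n x hx j (by omega)).1).1

end HypFilling

lemma doubling_iter {X : Type*} [MetricSpace X] {K : ℝ} (hK : 1 ≤ K) (h : IsDoublingWith X K)
    (k : ℕ) : ∀ (x : X) (r : ℝ), 0 < r → ∃ t : Finset X, (t.card : ℝ) ≤ K ^ k ∧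
    Metric.ball x r ⊆ ⋃ y ∈ t, Metric.ball y (r / 2 ^ k) := by
  classical
  induction k with
  | zero =>
    intro x r hr
    refine ⟨{x}, by simp, by simp⟩
  | succ k ih =>
    intro x r hr
    obtain ⟨t, ht, hc⟩ := ih x r hr
    have h' : ∀ y : X, ∃ s : Finset X, (s.card : ℝ) ≤ K ∧
      Metric.ball y (r / 2 ^ k) ⊆ ⋃ z ∈ s, Metric.ball z (r / 2 ^ k / 2) :=
      fun y => h y _ (by positivity)
    choose s hs hsc using h'
    refine ⟨t.biUnion s, ?_, ?_⟩
    · calc ((t.biUnion s).card : ℝ) ≤ ((∑ y ∈ t, (s y).card : ℕ) : ℝ) := by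
            exact_mod_cast Finset.card_biUnion_le
        _ = ∑ y ∈ t, ((s y).card : ℝ) := by push_cast; rfl
        _ ≤ ∑ y ∈ t, K := Finset.sum_le_sum fun y _ => hs y
        _ = t.card * K := by simp
        _ ≤ K ^ k * K := mul_le_mul_of_nonneg_right ht (by linarith)
        _ = K ^ (k + 1) := by ring
    · intro u hu
      have h1 := hc hu
      simp only [Set.mem_iUnion, exists_prop] at h1
      obtain ⟨y, hy, huy⟩ := h1
      have h2 := hsc y huy
      simp only [Set.mem_iUnion, exists_prop] at h2
      obtain ⟨z, hz, huz⟩ := h2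
      simp only [Set.mem_iUnion, exists_prop]
      refine ⟨z, Finset.mem_biUnion.2 ⟨y, hy, hz⟩, ?_⟩
      rwa [pow_succ, ← div_div]

lemma card_sep {X : Type*} [MetricSpace X] {K : ℝ} (hK : 1 ≤ K) (h : IsDoublingWith X K)
    (s : Finset X) (z : X) (e : ℝ) (he : 0 < e) (hs : ∀ x ∈ s, dist x z < 16 * e)
    (hsep : ∀ x ∈ s, ∀ y ∈ s, x ≠ y → e ≤ dist x y) : (s.card : ℝ) ≤ K ^ 5 := by
  classical
  obtain ⟨t, ht, hc⟩ := doubling_iter hK h 5 z (16 * e) (by positivity)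
  refine le_trans ?_ ht
  have h' : ∀ x ∈ s, ∃ y ∈ t, dist x y < e / 2 := by
    intro x hx
    have := hc (Metric.mem_ball.2 (hs x hx))
    simp only [Set.mem_iUnion, exists_prop, Metric.mem_ball] at this
    obtain ⟨y, hy, hd⟩ := this
    exact ⟨y, hy, by linarith⟩
  choose! g hg hgd using h'
  norm_cast
  apply Finset.card_le_card_of_injOn g
  · intro x hx
    exact hg x hx
  · intro x hx y hy hxy
    by_contra hne
    have h1 := hsep x hx y hy hne
    have h2 := hgd x hx
    have h3 := hgd y hy
    rw [← hxy] at h3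
    have := dist_triangle_right x y (g x)
    linarith

/-- Cutoff function. -/
def cutoff {X : Type*} [MetricSpace X] (x : X) (R : ℝ) (u : X) : ℝ :=
  max 0 (min 1 (2 - dist u x / R))

lemma cutoff_cont {X : Type*} [MetricSpace X] (x : X) (R : ℝ) : Continuous (cutoff x R) := by
  unfold cutoff
  fun_prop

lemma cutoff_nonneg {X : Type*} [MetricSpace X] (x : X) (R : ℝ) (u : X) : 0 ≤ cutoff x R u :=
  le_max_left _ _

lemma cutoff_le_one {X : Type*} [MetricSpace X] (x : X) (R : ℝ) (u : X) : cutoff x R u ≤ 1 :=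
  max_le zero_le_one (min_le_left _ _)

lemma cutoff_one {X : Type*} [MetricSpace X] (x : X) (R : ℝ) (hR : 0 < R) (u : X)
    (h : dist u x ≤ R) : cutoff x R u = 1 := by
  have : dist u x / R ≤ 1 := by rwa [div_le_one hR]
  unfold cutoff
  rw [min_eq_left (by linarith), max_eq_right zero_le_one]

lemma cutoff_zero {X : Type*} [MetricSpace X] (x : X) (R : ℝ) (hR : 0 < R) (u : X)
    (h : 2 * R ≤ dist u x) : cutoff x R u = 0 := by
  have : 2 ≤ dist u x / R := by rwa [le_div_iff₀ hR]
  unfold cutoff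
  exact max_eq_left ((min_le_right _ _).trans (by linarith))

lemma integral_seqMeas {X : Type*} [MetricSpace X] [MeasurableSpace X] [BorelSpace X]
    {a : ℝ} (F : HypFilling X a) (ρ C : ℕ → X → ℝ) (β : ℝ) (n : ℕ)
    (hw : ∀ x ∈ F.N n, 0 ≤ F.piW ρ n x ^ β * C n x) (f : X → ℝ) :
    ∫ z, f z ∂ seqMeas F ρ C β n = ∑ x ∈ F.N n, (F.piW ρ n x ^ β * C n x) * f x := by
  unfold seqMeas
  rw [integral_finsetSum_measure]
  · apply Finset.sum_congr rfl
    intro x hx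
    rw [integral_smul_measure, integral_dirac, ENNReal.toReal_ofReal (hw x hx), smul_eq_mul]
  · intro x _
    exact (integrable_dirac (by simp)).smul_measure ENNReal.ofReal_ne_top

lemma meas_cutoff {X : Type*} [MetricSpace X] [MeasurableSpace X] [BorelSpace X] (μ : Measure X)
    [IsFiniteMeasure μ] (x : X) (R : ℝ) (hR : 0 < R) :
    μ.real (Metric.ball x R) ≤ ∫ u, cutoff x R u ∂μ ∧
      ∫ u, cutoff x R u ∂μ ≤ μ.real (Metric.ball x (2 * R)) := by
  have hi : Integrable (cutoff x R) μ := by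
    refine Integrable.of_bound (C := 1) ?_ ?_
    · exact (cutoff_cont x R).measurable.aestronglyMeasurable
    · filter_upwards with u
      rw [Real.norm_of_nonneg (cutoff_nonneg x R u)]
      exact cutoff_le_one x R u
  have hind : ∀ s : ℝ, Integrable ((Metric.ball x s).indicator (1 : X → ℝ)) μ := fun s =>
    (integrable_const (1 : ℝ)).indicator measurableSet_ball
  rw [← integral_indicator_one measurableSet_ball, ← integral_indicator_one measurableSet_ball]
  constructor
  · apply integral_mono (hind _) hi
    intro u
    by_cases hu : u ∈ Metric.ball x R
    · rw [Set.indicator_of_mem hu, cutoff_one x R hR u (Metric.mem_ball.1 hu).le]; simp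
    · rw [Set.indicator_of_notMem hu]; exact cutoff_nonneg _ _ _
  · apply integral_mono hi (hind _)
    intro u
    by_cases hu : u ∈ Metric.ball x (2 * R)
    · rw [Set.indicator_of_mem hu]; exact cutoff_le_one _ _ _
    · rw [Set.indicator_of_notMem hu, cutoff_zero x R hR u (by simpa using hu)]

lemma filling_core
    (X : Type) [MetricSpace X] [CompactSpace X] [MeasurableSpace X] [BorelSpace X]
    (KD lam a β Kh Kv : ℝ)
    (F : HypFilling X a) (ρ C : ℕ → X → ℝ) (μ : Measure X)
    (hKD : 1 ≤ KD) (hlam : 32 ≤ lam) (ha : 768 ≤ a)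
    (hβ : 0 < β) (hKh : 1 ≤ Kh) (hKv : 1 ≤ Kv)
    (hdoub : IsDoublingWith X KD)
    (hρ : ∀ n : ℕ, ∀ x ∈ F.N n, 0 < ρ n x ∧ ρ n x < 1)
    (h1 : F.H1 ρ) (h2 : F.H2 lam ρ)
    (hC : ∀ n : ℕ, ∀ x ∈ F.N n, 0 < C n x)
    (hgentle : F.Gentle lam Kh Kv C)
    (hcomp : F.Compatible β C ρ)
    (hμ : ∃ φ : ℕ → ℕ, StrictMono φ ∧ ∀ f : X → ℝ, Continuous f →
      Filter.Tendsto (fun j => ∫ z, f z ∂ seqMeas F ρ C β (φ j)) Filter.atTop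
        (nhds (∫ z, f z ∂ μ))) :
    IsFiniteMeasure μ ∧ (∃ C₁ : ℝ, 1 < C₁ ∧ ∀ (x : X) (r : ℝ) (n : ℕ) (z : X),
        0 < r → 
        z ∈ F.N n → 2 * a ^ (-((n : ℤ) + 1)) ≤ r → r < 2 * a ^ (-(n : ℤ)) →
        dist z x < 2 * a ^ (-(n : ℤ)) → 0 ≤ F.piW ρ n z ^ β * C n z ∧
        C₁⁻¹ * (F.piW ρ n z ^ β * C n z) ≤ μ.real (Metric.ball x r) ∧
          μ.real (Metric.ball x (2 * r)) ≤ C₁ * (F.piW ρ n z ^ β * C n z)) := by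
  classical
  obtain ⟨φ, hφ, hlim⟩ := hμ
  obtain ⟨ηm, ηp, hηm, hηmp, hηp, hη⟩ := h1
  obtain ⟨K₀, hK₀, hH2⟩ := h2
  obtain ⟨K₂, hK₂, hcomp⟩ := hcomp
  obtain ⟨hgh, hgv⟩ := hgentle
  set w : ℕ → X → ℝ := fun n x => F.piW ρ n x ^ β * C n x with hwdef
  have hppos := F.piW_pos ha ρ hρ
  have hwpos : ∀ n, ∀ x ∈ F.N n, 0 < w n x := fun n x hx =>
    mul_pos (Real.rpow_pos_of_pos (hppos n x hx) _) (hC n x hx)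
  -- compatibility as finite sums
  have hcomp' : ∀ m : ℕ, ∀ x ∈ F.N m, ∀ n : ℕ, m < n →
      K₂⁻¹ * w m x ≤ ∑ y ∈ F.N n with F.anc (n - m) n y = x, w n y ∧
      ∑ y ∈ F.N n with F.anc (n - m) n y = x, w n y ≤ K₂ * w m x := by
    intro m x hx n hmn
    have h := hcomp m x hx n hmn
    have hset : {x' : X | F.Desc m x n x'} =
        ((F.N n).filter (fun y => F.anc (n - m) n y = x) : Finset X) := by
      ext y
      simp [HypFilling.Desc]
    rw [hset, finsum_mem_coe_finset] at h
    exact h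
  -- neighbours
  set Kn : ℝ := K₀ ^ β * Kh with hKn
  have hKn1 : 1 ≤ Kn := one_le_mul_of_one_le_of_one_le (Real.one_le_rpow hK₀ hβ.le) hKh
  have hnb : ∀ n, ∀ x ∈ F.N n, ∀ y ∈ F.N n, dist x y < 16 * a ^ (-(n : ℤ)) →
      w n x ≤ Kn * w n y := by
    intro n x hx y hy hd
    have he := HypFilling.e_pos ha n
    by_cases hxy : x = y
    · subst hxy
      exact le_mul_of_one_le_left (hwpos n x hx).le hKn1
    · have hH : F.Hor lam n x y := by
        refine ⟨hx, hy, hxy, y, ?_, ?_⟩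
        · rw [Metric.mem_ball, dist_comm]
          nlinarith
        · apply Metric.mem_ball_self
          positivity
      have e1 := hH2 n x y hH
      have e2 := hgh n x y hH
      have e3 : F.piW ρ n x ^ β ≤ K₀ ^ β * F.piW ρ n y ^ β := by
        rw [← Real.mul_rpow (by linarith) (hppos n y hy).le]
        exact Real.rpow_le_rpow (hppos n x hx).le e1 hβ.le
      calc w n x ≤ (K₀ ^ β * F.piW ρ n y ^ β) * (Kh * C n y) :=
            mul_le_mul e3 e2 (hC n x hx).le
              (mul_nonneg (by positivity) (Real.rpow_nonneg (hppos n y hy).le _))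
        _ = Kn * w n y := by simp only [hKn, hwdef]; ring
  -- vertical
  set V : ℝ := (ηm ^ β)⁻¹ * Kv with hV
  have hηβ : 0 < ηm ^ β := Real.rpow_pos_of_pos hηm _
  have hηβ1 : ηm ^ β ≤ 1 := Real.rpow_le_one hηm.le (by linarith) hβ.le
  have hV1 : 1 ≤ V := one_le_mul_of_one_le_of_one_le ((one_le_inv₀ hηβ).2 hηβ1) hKv
  have hvert : ∀ n, ∀ x ∈ F.N (n + 1), w n (F.parent n x) ≤ V * w (n + 1) x := by
    intro n x hx
    have hp := F.parent_mem n x hx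
    have e1 := (hgv n x hx).2
    have e2 : F.piW ρ n (F.parent n x) ^ β ≤ (ηm ^ β)⁻¹ * F.piW ρ (n + 1) x ^ β := by
      rw [F.piW_succ, Real.mul_rpow (hppos n _ hp).le (hρ _ _ hx).1.le,
        ← div_eq_inv_mul, le_div_iff₀ hηβ]
      exact mul_le_mul_of_nonneg_left (Real.rpow_le_rpow hηm.le (hη _ _ hx).1 hβ.le)
        (Real.rpow_nonneg (hppos n _ hp).le _)
    calc w n (F.parent n x) ≤ ((ηm ^ β)⁻¹ * F.piW ρ (n + 1) x ^ β) * (Kv * C (n + 1) x) :=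
          mul_le_mul e2 e1 (hC n _ hp).le
            (mul_nonneg (by positivity) (Real.rpow_nonneg (hppos _ x hx).le _))
      _ = V * w (n + 1) x := by simp only [hV, hwdef]; ring
  have hint : ∀ n (f : X → ℝ), ∫ z, f z ∂ seqMeas F ρ C β n = ∑ x ∈ F.N n, w n x * f x :=
    fun n f => integral_seqMeas F ρ C β n (fun x hx => (hwpos n x hx).le) f
  simp only [hint] at hlim
  -- finiteness
  have hfin : IsFiniteMeasure μ := by
    obtain ⟨x₀, hx₀⟩ := F.N0
    have hx₀' : x₀ ∈ F.N 0 := by rw [hx₀]; simp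
    have h := hlim (fun _ => 1) continuous_const
    have hlow : K₂⁻¹ * w 0 x₀ ≤ ∫ _z, (1 : ℝ) ∂μ := by
      apply ge_of_tendsto h
      filter_upwards [eventually_gt_atTop 0] with j hj
      have hj' : 0 < φ j := lt_of_lt_of_le hj (hφ.id_le j)
      refine (hcomp' 0 x₀ hx₀' (φ j) hj').1.trans ?_
      simp only [mul_one]
      exact Finset.sum_le_sum_of_subset_of_nonneg (Finset.filter_subset _ _)
        (fun y hy _ => (hwpos _ y hy).le)
    have hpos : 0 < K₂⁻¹ * w 0 x₀ := mul_pos (by positivity) (hwpos _ _ hx₀')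
    by_contra hnot
    have : ¬ Integrable (fun _ : X => (1 : ℝ)) μ := by
      rw [integrable_const_iff]
      simp [hnot]
    rw [integral_undef this] at hlow
    linarith
  refine ⟨hfin, ?_⟩
  -- constants
  set A : ℝ := K₂ * Kn * V ^ 2 with hA
  set B : ℝ := KD ^ 5 * K₂ * Kn with hB
  have hA1 : 1 ≤ A := one_le_mul_of_one_le_of_one_le
    (one_le_mul_of_one_le_of_one_le hK₂ hKn1) (one_le_pow₀ hV1)
  have hB1 : 1 ≤ B := one_le_mul_of_one_le_of_one_le
    (one_le_mul_of_one_le_of_one_le (one_le_pow₀ hKD) hK₂) hKn1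
  refine ⟨A + B, by linarith, ?_⟩
  intro x r n z hr hz hr1 hr2 hzx
  have hwz := hwpos n z hz
  have he0 := HypFilling.e_pos ha n
  have he1 := HypFilling.e_succ ha n
  have he2 := HypFilling.e_succ ha (n + 1)
  have he1p := HypFilling.e_pos ha (n + 1)
  have he2p := HypFilling.e_pos ha (n + 2)
  have hr1' : 2 * a ^ (-((n + 1 : ℕ) : ℤ)) ≤ r := by
    rw [Nat.cast_add, Nat.cast_one]; exact hr1
  refine ⟨hwz.le, ?_, ?_⟩
  · -- lower bound
    obtain ⟨y, hy, hxy⟩ := F.cover (n + 2) x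
    have hmain : K₂⁻¹ * w (n + 2) y ≤ ∫ u, cutoff x (r / 2) u ∂μ := by
      apply ge_of_tendsto (hlim _ (cutoff_cont x (r / 2)))
      filter_upwards [eventually_gt_atTop (n + 2)] with j hj
      have hj' : n + 2 < φ j := lt_of_lt_of_le hj (hφ.id_le j)
      refine (hcomp' (n + 2) y hy (φ j) hj').1.trans ?_
      refine le_trans ?_ (Finset.sum_le_sum_of_subset_of_nonneg (Finset.filter_subset
        (fun u => F.anc (φ j - (n + 2)) (φ j) u = y) _)
        (fun u hu _ => mul_nonneg (hwpos _ u hu).le (cutoff_nonneg _ _ _)))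
      apply Finset.sum_le_sum
      intro u hu
      obtain ⟨hu1, hu2⟩ := Finset.mem_filter.1 hu
      have hd := (F.anc_mem_dist ha (φ j) u hu1 (φ j - (n + 2)) (by omega)).2
      rw [hu2, show φ j - (φ j - (n + 2)) = n + 2 by omega] at hd
      have htri := dist_triangle_right u x y
      rw [cutoff_one x (r / 2) (by positivity) u (by linarith), mul_one]
    have hm2 := (meas_cutoff μ x (r / 2) (by positivity)).2
    rw [mul_div_cancel₀ r (two_ne_zero)] at hm2
    have hy1 := F.parent_mem (n + 1) y hy
    have hy2 := F.parent_mem n _ hy1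
    have hdist := (F.anc_mem_dist ha (n + 2) y hy 2 (by omega)).2
    have hanc : F.anc 2 (n + 2) y = F.parent n (F.parent (n + 1) y) := rfl
    rw [hanc, show n + 2 - 2 = n by omega] at hdist
    have hw1 : w n z ≤ Kn * w n (F.parent n (F.parent (n + 1) y)) := by
      apply hnb n z hz _ hy2
      have t1 := dist_triangle z x (F.parent n (F.parent (n + 1) y))
      have t2 := dist_triangle x y (F.parent n (F.parent (n + 1) y))
      linarith
    have hw2 := hvert n _ hy1
    have hw3 := hvert (n + 1) y hy
    have hw4 : w n z ≤ Kn * V ^ 2 * w (n + 2) y := by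
      calc w n z ≤ Kn * (V * (V * w (n + 2) y)) := by
            refine hw1.trans ?_
            gcongr
            refine hw2.trans ?_
            gcongr
        _ = _ := by ring
    have hA' : (A + B)⁻¹ ≤ A⁻¹ := by gcongr; linarith
    calc (A + B)⁻¹ * w n z ≤ A⁻¹ * (Kn * V ^ 2 * w (n + 2) y) := by
          gcongr
      _ = K₂⁻¹ * w (n + 2) y := by
          rw [hA]; field_simp
      _ ≤ _ := hmain.trans hm2
  · -- upper bound
    have hmain : ∫ u, cutoff x (2 * r) u ∂μ ≤ B * w n z := by
      apply le_of_tendsto (hlim _ (cutoff_cont x (2 * r)))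
      filter_upwards [eventually_gt_atTop n] with j hj
      have hj' : n < φ j := lt_of_lt_of_le hj (hφ.id_le j)
      set l := φ j with hl
      set s := (F.N l).filter (fun u => dist u x < 2 * (2 * r)) with hs
      set t := (F.N n).filter (fun u => dist u z < 16 * a ^ (-(n : ℤ))) with ht
      have hmaps : ∀ u ∈ s, F.anc (l - n) l u ∈ t := by
        intro u hu
        obtain ⟨hu1, hu2⟩ := Finset.mem_filter.1 hu
        have hd := F.anc_mem_dist ha l u hu1 (l - n) (by omega)
        rw [show l - (l - n) = n by omega] at hd
        refine Finset.mem_filter.2 ⟨hd.1, ?_⟩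
        have t1 := dist_triangle_left (F.anc (l - n) l u) z u
        have t2 := dist_triangle_right u z x
        linarith [hd.2]
      calc ∑ u ∈ F.N l, w l u * cutoff x (2 * r) u ≤ ∑ u ∈ s, w l u := by
            rw [hs, Finset.sum_filter]
            apply Finset.sum_le_sum
            intro u hu
            split_ifs with h
            · exact mul_le_of_le_one_right (hwpos l u hu).le (cutoff_le_one _ _ _)
            · rw [cutoff_zero x (2 * r) (by positivity) u (not_lt.1 h), mul_zero]
        _ = ∑ v ∈ t, ∑ u ∈ s with F.anc (l - n) l u = v, w l u :=
            (Finset.sum_fiberwise_of_maps_to hmaps _).symm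
        _ ≤ ∑ v ∈ t, K₂ * (Kn * w n z) := by
            apply Finset.sum_le_sum
            intro v hv
            obtain ⟨hv1, hv2⟩ := Finset.mem_filter.1 hv
            refine le_trans ?_ ((hcomp' n v hv1 l hj').2.trans ?_)
            · apply Finset.sum_le_sum_of_subset_of_nonneg
              · exact Finset.filter_subset_filter _ (Finset.filter_subset _ _)
              · intro u hu _
                exact (hwpos l u (Finset.mem_filter.1 hu).1).le
            · gcongr
              exact hnb n v hv1 z hz hv2
        _ = t.card * (K₂ * (Kn * w n z)) := by simp
        _ ≤ KD ^ 5 * (K₂ * (Kn * w n z)) := by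
            gcongr
            apply card_sep hKD hdoub t z _ he0
            · intro u hu
              exact (Finset.mem_filter.1 hu).2
            · intro u hu v hv huv
              exact F.sep n u (Finset.mem_filter.1 hu).1 v (Finset.mem_filter.1 hv).1 huv
        _ = B * w n z := by rw [hB]; ring
    have := (meas_cutoff μ x (2 * r) (by positivity)).1
    have hle : B * w n z ≤ (A + B) * w n z := by
      gcongr
      linarith
    linarith

/-- Lemma 3.7 (cf. Carrasco Piaggo, Lemma 2.7): if `ρ` satisfies (H1), (H2) and is
`(β,C)`-compatible for a gentle `C`, then any weak-* subsequential limit `μ` of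
`μₙ = Σ_{B ∈ Sₙ} π(B)^β C(B) δ_{x_B}` satisfies
`C₁⁻¹ π(B)^β C(B) ≤ μ(B(x,r)) ≤ C₁ π(B)^β C(B)` for every ball `B(x,r)` with
`r ≤ diam(X,d)/2` and every `B ∈ A_S(B(x,r))`; moreover `μ` is volume doubling on `(X,d)`. -/
theorem measure_from_filling
    (X : Type) [MetricSpace X] [CompactSpace X] [MeasurableSpace X] [BorelSpace X]
    (KD KP lam a β Kh Kv : ℝ)
    (F : HypFilling X a) (ρ C : ℕ → X → ℝ) (μ : Measure X)
    (hKD : 1 ≤ KD) (hKP : 1 < KP) (hlam : 32 ≤ lam) (ha : 24 * max lam KP ≤ a)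
    (hβ : 0 < β) (hKh : 1 ≤ Kh) (hKv : 1 ≤ Kv)
    (hdiam : Metric.diam (Set.univ : Set X) = 1 / 2)
    (hdoub : IsDoublingWith X KD) (hperf : IsUniformlyPerfectWith X KP)
    (hρ : ∀ n : ℕ, ∀ x ∈ F.N n, 0 < ρ n x ∧ ρ n x < 1)
    (h1 : F.H1 ρ) (h2 : F.H2 lam ρ)
    (hC : ∀ n : ℕ, ∀ x ∈ F.N n, 0 < C n x)
    (hgentle : F.Gentle lam Kh Kv C)
    (hcomp : F.Compatible β C ρ)
    (hμ : ∃ φ : ℕ → ℕ, StrictMono φ ∧ ∀ f : X → ℝ, Continuous f →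
      Filter.Tendsto (fun j => ∫ z, f z ∂ seqMeas F ρ C β (φ j)) Filter.atTop
        (nhds (∫ z, f z ∂ μ))) :
    (∃ C₁ : ℝ, 1 < C₁ ∧ ∀ (x : X) (r : ℝ) (n : ℕ) (z : X),
        0 < r → r ≤ Metric.diam (Set.univ : Set X) / 2 →
        z ∈ F.N n → 2 * a ^ (-((n : ℤ) + 1)) ≤ r → r < 2 * a ^ (-(n : ℤ)) →
        dist z x < 2 * a ^ (-(n : ℤ)) →
        ENNReal.ofReal (C₁⁻¹ * (F.piW ρ n z ^ β * C n z)) ≤ μ (Metric.ball x r) ∧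
          μ (Metric.ball x r) ≤ ENNReal.ofReal (C₁ * (F.piW ρ n z ^ β * C n z))) ∧
      ∃ CD : ℝ, 0 < CD ∧ ∀ (x : X) (r : ℝ), 0 < r →
        μ (Metric.ball x (2 * r)) ≤ ENNReal.ofReal CD * μ (Metric.ball x r) := by
  have ha' : 768 ≤ a := by
    have := le_max_left lam KP
    linarith
  obtain ⟨hfin, C₁, hC₁, hmain⟩ := filling_core X KD lam a β Kh Kv F ρ C μ hKD hlam ha' hβ hKh hKv
    hdoub hρ h1 h2 hC hgentle hcomp hμ
  have hC0 : 0 < C₁ := by linarith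
  refine ⟨⟨C₁, hC₁, ?_⟩, C₁ ^ 2, by positivity, ?_⟩
  · intro x r n z hr _ hz hr1 hr2 hd
    obtain ⟨_, hlo, hup⟩ := hmain x r n z hr hz hr1 hr2 hd
    constructor
    · exact (ENNReal.ofReal_le_iff_le_toReal (measure_ne_top _ _)).2 hlo
    · have hsub : μ (Metric.ball x r) ≤ μ (Metric.ball x (2 * r)) :=
        measure_mono (Metric.ball_subset_ball (by linarith))
      refine hsub.trans ?_
      rw [← ENNReal.ofReal_toReal (measure_ne_top μ (Metric.ball x (2 * r)))]
      exact ENNReal.ofReal_le_ofReal hup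
  · intro x r hr
    rw [← ENNReal.ofReal_toReal (measure_ne_top μ (Metric.ball x (2 * r))),
      ← ENNReal.ofReal_toReal (measure_ne_top μ (Metric.ball x r)),
      ← ENNReal.ofReal_mul (by positivity)]
    apply ENNReal.ofReal_le_ofReal
    change μ.real _ ≤ C₁ ^ 2 * μ.real _
    by_cases hr2 : r < 2
    · obtain ⟨n, hn1, hn2⟩ : ∃ n : ℕ, 2 * a ^ (-((n : ℤ) + 1)) ≤ r ∧ r < 2 * a ^ (-(n : ℤ)) := by
        have h0 : 0 < a := by linarith
        have hex : ∃ n : ℕ, a⁻¹ ^ (n + 1) ≤ r / 2 := by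
          obtain ⟨n, hn⟩ := exists_pow_lt_of_lt_one (x := r / 2) (y := a⁻¹)
            (by positivity) (inv_lt_one_of_one_lt₀ (by linarith))
          exact ⟨n, (pow_le_pow_of_le_one (by positivity)
            (inv_le_one_of_one_le₀ (by linarith)) (Nat.le_succ n)).trans hn.le⟩
        classical
        obtain ⟨n, hn1, hn2⟩ : ∃ n : ℕ, a⁻¹ ^ (n + 1) ≤ r / 2 ∧ r / 2 < a⁻¹ ^ n := by
          refine ⟨Nat.find hex, Nat.find_spec hex, ?_⟩
          rcases hk : Nat.find hex with _ | k
          · rw [pow_zero]; linarith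
          · exact not_le.1 (Nat.find_min hex (m := k) (by omega))
        refine ⟨n, ?_, ?_⟩
        · have : a ^ (-((n : ℤ) + 1)) = a⁻¹ ^ (n + 1) := by
            rw [inv_pow, zpow_neg]; norm_cast
          rw [this]; linarith
        · have : a ^ (-(n : ℤ)) = a⁻¹ ^ n := by
            rw [inv_pow, zpow_neg]; norm_cast
          rw [this]; linarith
      obtain ⟨z, hz, hd⟩ := F.cover n x
      obtain ⟨hw, hlo, hup⟩ := hmain x r n z hr hz hn1 hn2 (by rwa [dist_comm])
      calc μ.real (Metric.ball x (2 * r)) ≤ C₁ * (F.piW ρ n z ^ β * C n z) := hup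
        _ = C₁ ^ 2 * (C₁⁻¹ * (F.piW ρ n z ^ β * C n z)) := by field_simp
        _ ≤ _ := by gcongr
    · have huniv : Metric.ball x (2 * r) ⊆ Metric.ball x r := by
        intro u _
        rw [Metric.mem_ball]
        have := Metric.dist_le_diam_of_mem (isCompact_univ (X := X)).isBounded
          (Set.mem_univ u) (Set.mem_univ x)
        linarith
      calc μ.real (Metric.ball x (2 * r)) ≤ μ.real (Metric.ball x r) := measureReal_mono huniv
        _ ≤ _ := le_mul_of_one_le_left measureReal_nonneg (one_le_pow₀ hC₁.le)
end
end

section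
/- Let d₁ and d₂ be metrics on a set X that are quasisymmetric to each other, and suppose (X,d₁) and (X,d₂) are each uniformly perfect. Let m₁ and m₂ be Borel measures on X, each satisfying volume doubling (VD) with respect to d₁, and suppose m₁ and m₂ are A∞-related with respect to d₁. Then m₁ and m₂ each satisfy volume doubling with respect to d₂, and m₁ and m₂ are A∞-related with respect to d₂. -/
open Metric Set MeasureTheory Filter Topology
open scoped BigOperators ENNReal NNReal

noncomputable section

/-- `θ` is a metric (distance function) on `X`. -/
def IsMetricOn (X : Type*) (θ : X → X → ℝ) : Prop :=
  (∀ x y : X, 0 ≤ θ x y) ∧ (∀ x y : X, θ x y = 0 ↔ x = y) ∧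
    (∀ x y : X, θ x y = θ y x) ∧ ∀ x y z : X, θ x z ≤ θ x y + θ y z

/-- A distortion function: an increasing self-homeomorphism of `[0,∞)`. -/
def IsDistortion (η : ℝ → ℝ) : Prop :=
  StrictMonoOn η (Set.Ici 0) ∧ ContinuousOn η (Set.Ici 0) ∧ η '' Set.Ici 0 = Set.Ici 0

/-- `θ` is `η`-quasisymmetric to `d`: `θ(x,u)/θ(x,v) ≤ η(d(x,u)/d(x,v))` whenever `x ≠ v`. -/
def QuasisymmetricWith {X : Type*} (η : ℝ → ℝ) (d θ : X → X → ℝ) : Prop :=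
  ∀ x u v : X, x ≠ v → θ x u ≤ η (d x u / d x v) * θ x v

/-- Diameter of a set with respect to a distance function. -/
noncomputable def diamWith {X : Type*} (θ : X → X → ℝ) (A : Set X) : ℝ :=
  sSup (Set.image2 θ A A)

/-- Open ball with respect to a distance function. -/
def mball {X : Type*} (θ : X → X → ℝ) (x : X) (r : ℝ) : Set X := {y | θ x y < r}

/-- The measure `μ` satisfies volume doubling (VD) with respect to the distance function `θ`. -/
def VDFor {X : Type*} [MeasurableSpace X] (θ : X → X → ℝ)
    (μ : MeasureTheory.Measure X) : Prop :=
  ∃ C : ℝ, 0 < C ∧ ∀ (x : X) (r : ℝ), 0 < r →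
    μ (mball θ x (2 * r)) ≤ ENNReal.ofReal C * μ (mball θ x r)

/-- `μ` is A∞-related to `m` with respect to the distance function `θ`: for every `ε > 0` there
is `δ > 0` such that for every ball `B` and Borel `E ⊆ B`, `m(E) < δ·m(B)` implies
`μ(E) < ε·μ(B)`. -/
def AInftyFor {X : Type*} [MeasurableSpace X] (θ : X → X → ℝ)
    (m μ : MeasureTheory.Measure X) : Prop :=
  ∀ ε : ℝ, 0 < ε → ∃ δ : ℝ, 0 < δ ∧ ∀ (x : X) (r : ℝ) (E : Set X), 0 < r →
    MeasurableSet E → E ⊆ mball θ x r →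
    m E < ENNReal.ofReal δ * m (mball θ x r) →
    μ E < ENNReal.ofReal ε * μ (mball θ x r)

/-- `(X,θ)` is `K`-uniformly perfect, for a raw distance function `θ`. -/
def UniformlyPerfectFor {X : Type*} (θ : X → X → ℝ) (K : ℝ) : Prop :=
  ∀ (x : X) (r : ℝ), 0 < r → ((mball θ x r)ᶜ).Nonempty →
    (mball θ x r \ mball θ x (r / K)).Nonempty

/-- A distortion function takes the value one at a positive point. -/
lemma IsDistortion.exists_small {η : ℝ → ℝ} (h : IsDistortion η) :
    ∃ t : ℝ, 0 < t ∧ η t = 1 := by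
  obtain ⟨hm, -, hi⟩ := h
  have h1 : (1 : ℝ) ∈ η '' Set.Ici 0 := by rw [hi]; simp
  have h0 : (0 : ℝ) ∈ η '' Set.Ici 0 := by rw [hi]; simp
  obtain ⟨t, ht, hte⟩ := h1
  obtain ⟨s, hs, hse⟩ := h0
  refine ⟨t, ?_, hte⟩
  have ht' : (0 : ℝ) ≤ t := ht
  have hs' : (0 : ℝ) ≤ s := hs
  have : s < t := (hm.lt_iff_lt hs ht).1 (by rw [hte, hse]; norm_num)
  linarith

/-- Comparison of balls under quasisymmetry. -/
lemma ball_comparison {X : Type} [MetricSpace X] {θ : X → X → ℝ}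
    (hθ : IsMetricOn X θ) {η₁ η₂ : ℝ → ℝ} (h₁ : IsDistortion η₁) (h₂ : IsDistortion η₂)
    (q₁ : QuasisymmetricWith η₁ (fun x y : X => dist x y) θ)
    (q₂ : QuasisymmetricWith η₂ θ (fun x y : X => dist x y))
    {K : ℝ} (hK : 1 < K) (hup : UniformlyPerfectFor θ K) :
    ∃ n : ℕ, ∀ (x : X) (r : ℝ), 0 < r → ∃ s : ℝ, 0 < s ∧
      mball (fun x y : X => dist x y) x s ⊆ mball θ x r ∧
      mball θ x (2 * r) ⊆ mball (fun x y : X => dist x y) x (2 ^ n * s) := by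
  obtain ⟨hnn, hzero, -, -⟩ := hθ
  obtain ⟨t, ht, hte⟩ := h₁.exists_small
  obtain ⟨n, hn⟩ := pow_unbounded_of_one_lt ((η₂ (2 * K)) / t) (one_lt_two)
  refine ⟨n, fun x r hr => ?_⟩
  have mono₂ : ∀ a b : ℝ, 0 ≤ a → a ≤ b → η₂ a ≤ η₂ b := fun a b ha hab =>
    h₂.1.monotoneOn ha (ha.trans hab) hab
  have hpow : (1 : ℝ) ≤ 2 ^ n := one_le_pow₀ (by norm_num)
  by_cases hc : ((mball θ x r)ᶜ).Nonempty
  · obtain ⟨y, hy1, hy2⟩ := hup x r hr hc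
    have hy1 : θ x y < r := hy1
    have hy2 : r / K ≤ θ x y := not_lt.1 hy2
    have hK0 : 0 < K := by linarith
    have hpos : 0 < θ x y := lt_of_lt_of_le (by positivity) hy2
    have hxy : x ≠ y := fun h => hpos.ne' ((hzero x y).2 h)
    have hD : 0 < dist x y := dist_pos.2 hxy
    refine ⟨t * dist x y, by positivity, ?_, ?_⟩
    · intro u hu
      have hu : dist x u < t * dist x y := hu
      have hq := q₁ x u y hxy
      have hle : dist x u / dist x y ≤ t := by
        rw [div_le_iff₀ hD]; exact hu.le
      have h0 : 0 ≤ dist x u / dist x y := by positivity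
      have : η₁ (dist x u / dist x y) ≤ 1 := by
        rw [← hte]; exact h₁.1.monotoneOn h0 ht.le hle
      change θ x u < r
      nlinarith
    · intro u hu
      have hu : θ x u < 2 * r := hu
      have hq := q₂ x u y hxy
      have hle : θ x u / θ x y ≤ 2 * K := by
        rw [div_le_iff₀ hpos]
        rw [div_le_iff₀ hK0] at hy2
        nlinarith
      have hm := mono₂ _ _ (div_nonneg (hnn x u) hpos.le) hle
      rw [div_lt_iff₀ ht] at hn
      change dist x u < 2 ^ n * (t * dist x y)
      have hq : dist x u ≤ η₂ (θ x u / θ x y) * dist x y := hq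
      nlinarith
  · have hall : ∀ u, θ x u < r := fun u => by
      by_contra hcon
      exact hc ⟨u, hcon⟩
    have hbd : ∃ M : ℝ, 0 < M ∧ ∀ u, dist x u < M := by
      by_cases hy : ∃ y, x ≠ y
      · obtain ⟨y, hxy⟩ := hy
        have hpos : 0 < θ x y := lt_of_le_of_ne (hnn x y) (fun h => hxy ((hzero x y).1 h.symm))
        have hb : ∀ u, dist x u ≤ η₂ (r / θ x y) * dist x y := fun u => by
          refine (q₂ x u y hxy).trans ?_
          exact mul_le_mul_of_nonneg_right (mono₂ _ _ (div_nonneg (hnn x u) hpos.le)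
            (div_le_div_of_nonneg_right (hall u).le hpos.le)) dist_nonneg
        refine ⟨η₂ (r / θ x y) * dist x y + 1, ?_, fun u => by linarith [hb u]⟩
        have := hb x
        rw [dist_self] at this
        linarith
      · push Not at hy
        exact ⟨1, one_pos, fun u => by rw [← hy u, dist_self]; exact one_pos⟩
    obtain ⟨M, hM, hMu⟩ := hbd
    refine ⟨M, hM, fun u _ => hall u, fun u _ => ?_⟩
    change dist x u < 2 ^ n * M
    nlinarith [hMu u]

/-- Iterated doubling. -/
lemma VD_iterate {X : Type} [MeasurableSpace X] {d : X → X → ℝ} {μ : Measure X}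
    {C : ℝ} (h : ∀ (x : X) (r : ℝ), 0 < r →
      μ (mball d x (2 * r)) ≤ ENNReal.ofReal C * μ (mball d x r)) (n : ℕ) (x : X) (s : ℝ)
    (hs : 0 < s) :
    μ (mball d x (2 ^ n * s)) ≤ ENNReal.ofReal C ^ n * μ (mball d x s) := by
  induction n with
  | zero => simp
  | succ n ih =>
    calc μ (mball d x (2 ^ (n + 1) * s)) = μ (mball d x (2 * (2 ^ n * s))) := by
          congr 2; ring
      _ ≤ ENNReal.ofReal C * μ (mball d x (2 ^ n * s)) := h _ _ (by positivity)
      _ ≤ ENNReal.ofReal C * (ENNReal.ofReal C ^ n * μ (mball d x s)) := by gcongr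
      _ = _ := by rw [pow_succ', mul_assoc]

/-- Doubling transfers between metrics with comparable balls. -/
lemma VD_transfer {X : Type} [MeasurableSpace X] {d θ : X → X → ℝ} {μ : Measure X}
    (hvd : VDFor d μ) {n : ℕ} (hb : ∀ (x : X) (r : ℝ), 0 < r → ∃ s : ℝ, 0 < s ∧
      mball d x s ⊆ mball θ x r ∧ mball θ x (2 * r) ⊆ mball d x (2 ^ n * s)) :
    VDFor θ μ := by
  obtain ⟨C, hC, h⟩ := hvd
  refine ⟨C ^ n, by positivity, fun x r hr => ?_⟩
  obtain ⟨s, hs, hi, ho⟩ := hb x r hr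
  rw [ENNReal.ofReal_pow hC.le]
  calc _ ≤ _ := measure_mono ho
    _ ≤ _ := VD_iterate h n x s hs
    _ ≤ _ := by gcongr

/-- The A-infinity relation transfers between metrics with comparable balls. -/
lemma AInfty_transfer {X : Type} [MeasurableSpace X] {d θ : X → X → ℝ} {m μ : Measure X}
    (hvd : VDFor d μ) (hA : AInftyFor d m μ) {n : ℕ}
    (hb : ∀ (x : X) (r : ℝ), 0 < r → ∃ s : ℝ, 0 < s ∧
      mball d x s ⊆ mball θ x r ∧ mball θ x (2 * r) ⊆ mball d x (2 ^ n * s)) :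
    AInftyFor θ m μ := by
  obtain ⟨C, hC, h⟩ := hvd
  intro ε hε
  obtain ⟨δ, hδ, hE⟩ := hA (ε / C ^ n) (by positivity)
  refine ⟨δ, hδ, fun x r E hr hEm hEs hlt => ?_⟩
  obtain ⟨s, hs, hi, ho⟩ := hb x r hr
  have hsub : mball θ x r ⊆ mball d x (2 ^ n * s) := fun u hu =>
    ho (show θ x u < 2 * r from lt_of_lt_of_le hu (by linarith))
  have key := hE x (2 ^ n * s) E (by positivity) hEm (hEs.trans hsub)
    (hlt.trans_le (by gcongr))
  refine key.trans_le ?_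
  calc _ ≤ ENNReal.ofReal (ε / C ^ n) * (ENNReal.ofReal C ^ n * μ (mball d x s)) := by
        gcongr; exact VD_iterate h n x s hs
    _ = ENNReal.ofReal ε * μ (mball d x s) := by
        rw [← mul_assoc, ← ENNReal.ofReal_pow hC.le, ← ENNReal.ofReal_mul (by positivity),
          div_mul_cancel₀ _ (by positivity)]
    _ ≤ _ := by gcongr

/-- Lemma 4.3: if `d₁ = dist` and `d₂ = θ` are mutually quasisymmetric metrics on `X`, both
uniformly perfect, and `m₁, m₂` are Borel measures that are doubling and A∞-related with
respect to `d₁`, then `m₁` and `m₂` are doubling and A∞-related with respect to `d₂`. -/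
theorem Ainfty_invariant_under_quasisymmetry
    (X : Type) [MetricSpace X] [MeasurableSpace X] [BorelSpace X]
    (θ : X → X → ℝ) (m₁ m₂ : Measure X)
    (hθ : IsMetricOn X θ)
    (hqs₁ : ∃ η : ℝ → ℝ, IsDistortion η ∧
      QuasisymmetricWith η (fun x y : X => dist x y) θ)
    (hqs₂ : ∃ η : ℝ → ℝ, IsDistortion η ∧
      QuasisymmetricWith η θ (fun x y : X => dist x y))
    (hup₁ : ∃ K : ℝ, 1 < K ∧ UniformlyPerfectFor (fun x y : X => dist x y) K)
    (hup₂ : ∃ K : ℝ, 1 < K ∧ UniformlyPerfectFor θ K)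
    (hpos₁ : ∀ (x : X) (r : ℝ), 0 < r →
      0 < m₁ (Metric.ball x r) ∧ m₁ (Metric.ball x r) < ⊤)
    (hpos₂ : ∀ (x : X) (r : ℝ), 0 < r →
      0 < m₂ (Metric.ball x r) ∧ m₂ (Metric.ball x r) < ⊤)
    (hvd₁ : VDFor (fun x y : X => dist x y) m₁)
    (hvd₂ : VDFor (fun x y : X => dist x y) m₂)
    (hA₁₂ : AInftyFor (fun x y : X => dist x y) m₁ m₂)
    (hA₂₁ : AInftyFor (fun x y : X => dist x y) m₂ m₁) :
    (VDFor θ m₁ ∧ VDFor θ m₂) ∧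
      AInftyFor θ m₁ m₂ ∧ AInftyFor θ m₂ m₁ := by
  obtain ⟨η₁, h₁, q₁⟩ := hqs₁
  obtain ⟨η₂, h₂, q₂⟩ := hqs₂
  obtain ⟨K, hK, hup⟩ := hup₂
  obtain ⟨n, hb⟩ := ball_comparison hθ h₁ h₂ q₁ q₂ hK hup
  exact ⟨⟨VD_transfer hvd₁ hb, VD_transfer hvd₂ hb⟩,
    AInfty_transfer hvd₂ hA₁₂ hb, AInfty_transfer hvd₁ hA₂₁ hb⟩
end
end

section
/- Let m be Lebesgue measure on ℝ² and let μ be a Borel measure on ℝ² of the form dμ = w·dm with w : ℝ² → [0,∞) locally integrable, such that μ satisfies volume doubling (VD) with respect to the Euclidean metric and μ is A∞-related to m. For x,y ∈ ℝ² set h(x,y) := μ(B_{x,y})^{1/2}, where B_{x,y} is the open Euclidean ball with center (x+y)/2 and radius |x−y|/2, and let d_h(x,y) := inf{ Σ_{i=0}^{N−1} h(x_i,x_{i+1}) : N ∈ ℕ, x₀ = x, x_N = y, x₁,…,x_{N−1} ∈ ℝ² }. Assume the strong A∞ condition: there is C > 0 with d_h(x,y) ≥ C^{-1}·h(x,y)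 for all x,y ∈ ℝ². Then d_h is a metric on ℝ² that is quasisymmetric to the Euclidean metric, and there exists C₁ > 1 such that C₁^{-1}·r² ≤ μ(B_{d_h}(x,r)) ≤ C₁·r² for all x ∈ ℝ² and r > 0, where B_{d_h}(x,r) denotes the open d_h-ball. -/
open Metric Set MeasureTheory Filter Topology
open scoped BigOperators ENNReal NNReal

noncomputable section

/-- The weighted measure `dμ = w·dm` on `ℝ²` (`m` = Lebesgue measure). -/
noncomputable def muW (w : EuclideanSpace ℝ (Fin 2) → ℝ) :
    Measure (EuclideanSpace ℝ (Fin 2)) :=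
  volume.withDensity fun z => ENNReal.ofReal (w z)

/-- `h(x,y) := μ(B_{x,y})^{1/2}`, where `B_{x,y}` is the Euclidean ball with center
`(x+y)/2` and radius `|x−y|/2`. -/
noncomputable def hW (w : EuclideanSpace ℝ (Fin 2) → ℝ)
    (x y : EuclideanSpace ℝ (Fin 2)) : ℝ :=
  Real.sqrt (muW w (Metric.ball (midpoint ℝ x y) (dist x y / 2))).toReal

/-- The maximal semimetric `d_h` induced by `h`: the infimum of `Σᵢ h(xᵢ,xᵢ₊₁)` over finite
chains from `x` to `y`. -/
noncomputable def dhW (w : EuclideanSpace ℝ (Fin 2) → ℝ)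
    (x y : EuclideanSpace ℝ (Fin 2)) : ℝ :=
  sInf {t : ℝ | ∃ (N : ℕ) (c : ℕ → EuclideanSpace ℝ (Fin 2)), c 0 = x ∧ c N = y ∧
    t = ∑ i ∈ Finset.range N, hW w (c i) (c (i + 1))}

/-- Real-valued volume of Euclidean balls. -/
def VW (w : EuclideanSpace ℝ (Fin 2) → ℝ) (x : EuclideanSpace ℝ (Fin 2)) (r : ℝ) : ℝ :=
  (muW w (Metric.ball x r)).toReal

lemma mball_dist_eq (x : EuclideanSpace ℝ (Fin 2)) (r : ℝ) :
    mball (fun x y : EuclideanSpace ℝ (Fin 2) => dist x y) x r = Metric.ball x r := by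
  ext y
  simp [mball, Metric.mem_ball, dist_comm]

lemma muW_ball_lt_top (w : EuclideanSpace ℝ (Fin 2) → ℝ)
    (hloc : MeasureTheory.LocallyIntegrable w volume)
    (x : EuclideanSpace ℝ (Fin 2)) (r : ℝ) : muW w (Metric.ball x r) < ∞ := by
  have h1 : IntegrableOn w (Metric.closedBall x r) volume :=
    hloc.integrableOn_isCompact (isCompact_closedBall x r)
  refine lt_of_le_of_lt (measure_mono Metric.ball_subset_closedBall) ?_
  rw [muW, withDensity_apply _ measurableSet_closedBall]
  exact h1.lintegral_lt_top

lemma VW_mono (w : EuclideanSpace ℝ (Fin 2) → ℝ)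
    (hloc : MeasureTheory.LocallyIntegrable w volume)
    {x y : EuclideanSpace ℝ (Fin 2)} {r s : ℝ} (h : Metric.ball x r ⊆ Metric.ball y s) :
    VW w x r ≤ VW w y s :=
  ENNReal.toReal_mono (muW_ball_lt_top w hloc y s).ne (measure_mono h)

lemma VW_pos (w : EuclideanSpace ℝ (Fin 2) → ℝ)
    (hloc : MeasureTheory.LocallyIntegrable w volume)
    (hA : AInftyFor (fun x y : EuclideanSpace ℝ (Fin 2) => dist x y) volume (muW w))
    (x : EuclideanSpace ℝ (Fin 2)) {r : ℝ} (hr : 0 < r) : 0 < VW w x r := by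
  obtain ⟨δ, hδ, H⟩ := hA 1 one_pos
  have := H x r ∅ hr MeasurableSet.empty (empty_subset _) (by
    rw [mball_dist_eq, measure_empty]
    exact ENNReal.mul_pos (by simpa using hδ) (Metric.measure_ball_pos _ _ hr).ne')
  rw [mball_dist_eq] at this
  refine ENNReal.toReal_pos ?_ (muW_ball_lt_top w hloc x r).ne
  intro h0
  simp [h0] at this

lemma VW_doubling (w : EuclideanSpace ℝ (Fin 2) → ℝ)
    (hloc : MeasureTheory.LocallyIntegrable w volume)
    (hVD : VDFor (fun x y : EuclideanSpace ℝ (Fin 2) => dist x y) (muW w)) :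
    ∃ D : ℝ, 2 ≤ D ∧ ∀ x r, 0 < r → VW w x (2 * r) ≤ D * VW w x r := by
  obtain ⟨C, hC, H⟩ := hVD
  refine ⟨max C 2, le_max_right _ _, fun x r hr => ?_⟩
  have h1 := H x r hr
  rw [mball_dist_eq, mball_dist_eq] at h1
  have h2 := ENNReal.toReal_mono
    (ENNReal.mul_ne_top ENNReal.ofReal_ne_top (muW_ball_lt_top w hloc x r).ne) h1
  rw [ENNReal.toReal_mul, ENNReal.toReal_ofReal hC.le] at h2
  exact h2.trans (mul_le_mul_of_nonneg_right (le_max_left _ _) ENNReal.toReal_nonneg)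

lemma VW_reverse (w : EuclideanSpace ℝ (Fin 2) → ℝ)
    (hloc : MeasureTheory.LocallyIntegrable w volume)
    (hA : AInftyFor (fun x y : EuclideanSpace ℝ (Fin 2) => dist x y) volume (muW w)) :
    ∃ τ : ℝ, 0 < τ ∧ τ < 1 ∧ ∀ x r, 0 < r → VW w x (τ * r) ≤ (1 / 4) * VW w x r := by
  obtain ⟨δ, hδ, H⟩ := hA (1 / 4) (by norm_num)
  refine ⟨min (1 / 2) (δ / 2), by positivity,
    lt_of_le_of_lt (min_le_left _ _) (by norm_num), fun x r hr => ?_⟩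
  set τ := min (1 / 2 : ℝ) (δ / 2) with hτ
  have hτ0 : 0 < τ := by positivity
  have hτ1 : τ ≤ 1 / 2 := min_le_left _ _
  have hτ2 : τ ≤ δ / 2 := min_le_right _ _
  have h1 := H x r (Metric.ball x (τ * r)) hr measurableSet_ball
    (by rw [mball_dist_eq]; exact Metric.ball_subset_ball (by nlinarith)) (by
      rw [mball_dist_eq, Measure.addHaar_ball_mul_of_pos _ _ hτ0, Measure.addHaar_ball_center _ x r]
      refine ENNReal.mul_lt_mul_left (Metric.measure_ball_pos _ _ hr).ne'
        measure_ball_lt_top.ne ?_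
      rw [ENNReal.ofReal_lt_ofReal_iff hδ]
      simp
      nlinarith)
  rw [mball_dist_eq] at h1
  have h2 := ENNReal.toReal_mono
    (ENNReal.mul_ne_top ENNReal.ofReal_ne_top (muW_ball_lt_top w hloc x r).ne) h1.le
  rwa [ENNReal.toReal_mul, ENNReal.toReal_ofReal (by norm_num)] at h2

/-- Abstract growth estimate for a doubling and reverse doubling function. -/
lemma growth (V : ℝ → ℝ) (hmono : Monotone V) (hpos : ∀ r, 0 < r → 0 < V r)
    (hzero : V 0 = 0) {D τ : ℝ} (hD : 2 ≤ D) (hτ0 : 0 < τ) (hτ1 : τ < 1)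
    (hd : ∀ r, 0 < r → V (2 * r) ≤ D * V r) (hrv : ∀ r, 0 < r → V (τ * r) ≤ (1 / 4) * V r)
    (t s : ℝ) (ht : 0 ≤ t) (hs : 0 < s) :
    V (t * s) ≤ D * 4 * (t ^ (Real.logb τ (1 / 4)) + t ^ (Real.logb 2 D)) * V s := by
  have hVs := hpos s hs
  have e1 : 0 ≤ t ^ (Real.logb τ (1 / 4)) := Real.rpow_nonneg ht _
  have e2 : 0 ≤ t ^ (Real.logb 2 D) := Real.rpow_nonneg ht _
  rcases ht.eq_or_lt with rfl | ht
  · rw [zero_mul, hzero]; positivity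
  have hdn : ∀ n : ℕ, V (2 ^ n * s) ≤ D ^ n * V s := by
    intro n
    induction n with
    | zero => simp
    | succ n ih =>
      have := hd (2 ^ n * s) (by positivity)
      calc V (2 ^ (n + 1) * s) = V (2 * (2 ^ n * s)) := by ring_nf
        _ ≤ D * V (2 ^ n * s) := this
        _ ≤ D * (D ^ n * V s) := by gcongr
        _ = _ := by ring
  have hrn : ∀ n : ℕ, V (τ ^ n * s) ≤ (1 / 4) ^ n * V s := by
    intro n
    induction n with
    | zero => simp
    | succ n ih =>
      have := hrv (τ ^ n * s) (by positivity)
      calc V (τ ^ (n + 1) * s) = V (τ * (τ ^ n * s)) := by ring_nf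
        _ ≤ (1 / 4) * V (τ ^ n * s) := this
        _ ≤ (1 / 4) * ((1 / 4) ^ n * V s) := by gcongr
        _ = _ := by ring
  rcases le_total t 1 with h1 | h1
  · obtain ⟨n, hn1, hn2⟩ := exists_nat_pow_near_of_lt_one ht h1 hτ0 hτ1
    have hlog : 0 ≤ Real.logb τ (1 / 4) :=
      Real.logb_nonneg_of_base_lt_one hτ0 hτ1 (by norm_num) (by norm_num)
    have h2 : ((1 : ℝ) / 4) ^ (n + 1) ≤ t ^ (Real.logb τ (1 / 4)) := by
      calc ((1 : ℝ) / 4) ^ (n + 1) = (τ ^ (Real.logb τ (1 / 4))) ^ (n + 1) := by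
            rw [Real.rpow_logb hτ0 hτ1.ne (by norm_num)]
        _ = (τ ^ (n + 1)) ^ (Real.logb τ (1 / 4)) := by
            rw [← Real.rpow_natCast, ← Real.rpow_natCast, ← Real.rpow_mul hτ0.le,
              ← Real.rpow_mul hτ0.le, mul_comm]
        _ ≤ _ := Real.rpow_le_rpow (by positivity) hn1.le hlog
    calc V (t * s) ≤ V (τ ^ n * s) := hmono (by gcongr)
      _ ≤ (1 / 4) ^ n * V s := hrn n
      _ ≤ _ := by
        gcongr
        rw [pow_succ] at h2
        nlinarith
  · obtain ⟨n, hn1, hn2⟩ := exists_nat_pow_near h1 (one_lt_two (α := ℝ))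
    have hlog : 0 ≤ Real.logb 2 D := Real.logb_nonneg (by norm_num) (by linarith)
    have h2 : D ^ n ≤ t ^ (Real.logb 2 D) := by
      calc D ^ n = ((2 : ℝ) ^ (Real.logb 2 D)) ^ n := by
            rw [Real.rpow_logb (by norm_num) (by norm_num) (by linarith)]
        _ = ((2 : ℝ) ^ n) ^ (Real.logb 2 D) := by
            rw [← Real.rpow_natCast, ← Real.rpow_natCast, ← Real.rpow_mul (by norm_num),
              ← Real.rpow_mul (by norm_num), mul_comm]
        _ ≤ _ := Real.rpow_le_rpow (by positivity) hn1 hlog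
    calc V (t * s) ≤ V (2 ^ (n + 1) * s) := hmono (by gcongr)
      _ ≤ D ^ (n + 1) * V s := hdn _
      _ ≤ _ := by
        gcongr
        rw [pow_succ]
        nlinarith

lemma scale (V : ℝ → ℝ) (hmono : Monotone V) (hpos : ∀ r, 0 < r → 0 < V r)
    {τ : ℝ} (hτ0 : 0 < τ)
    (hrv : ∀ r, 0 < r → V (τ * r) ≤ (1 / 4) * V r) (s : ℝ) (hs : 0 < s) :
    ∃ ρ : ℝ, 0 < ρ ∧ V ρ ≤ s ∧ s < V (2 * ρ) := by
  have hrn : ∀ (n : ℕ) (u : ℝ), 0 < u → V (τ ^ n * u) ≤ (1 / 4) ^ n * V u := by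
    intro n u hu
    induction n with
    | zero => simp
    | succ n ih =>
      have := hrv (τ ^ n * u) (by positivity)
      calc V (τ ^ (n + 1) * u) = V (τ * (τ ^ n * u)) := by ring_nf
        _ ≤ (1 / 4) * V (τ ^ n * u) := this
        _ ≤ (1 / 4) * ((1 / 4) ^ n * V u) := by gcongr
        _ = _ := by ring
  have hV1 := hpos 1 one_pos
  obtain ⟨k, hk⟩ := exists_pow_lt_of_lt_one (show 0 < s / V 1 by positivity)
    (show (1 / 4 : ℝ) < 1 by norm_num)
  obtain ⟨j, hj⟩ := exists_pow_lt_of_lt_one (show 0 < V 1 / s by positivity)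
    (show (1 / 4 : ℝ) < 1 by norm_num)
  set p := τ ^ k * 1 with hp
  have hp0 : 0 < p := by positivity
  have hVp : V p ≤ s := by
    refine (hrn k 1 one_pos).trans ?_
    rw [lt_div_iff₀ hV1] at hk
    exact hk.le
  set q := (τ ^ j)⁻¹ with hq
  have hq0 : 0 < q := by positivity
  have hVq : s < V q := by
    have h1 := hrn j q hq0
    rw [hq, mul_inv_cancel₀ (by positivity), ← hq] at h1
    rw [lt_div_iff₀ hs] at hj
    have h3 : (0 : ℝ) < (1 / 4) ^ j := by positivity
    exact lt_of_mul_lt_mul_left (hj.trans_le h1) h3.le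
  have hex : ∃ n : ℕ, s < V (2 ^ n * p) := by
    obtain ⟨n, hn⟩ := pow_unbounded_of_one_lt (q / p) (one_lt_two (α := ℝ))
    refine ⟨n, hVq.trans_le (hmono ?_)⟩
    rw [div_lt_iff₀ hp0] at hn
    exact hn.le
  classical
  have hf := Nat.find_spec hex
  have hm : ∀ m, m < Nat.find hex → ¬ _ := fun m hm => Nat.find_min hex hm
  generalize Nat.find hex = n at hf hm
  cases n with
  | zero => simp at hf; linarith
  | succ n =>
    refine ⟨2 ^ n * p, by positivity, not_lt.mp (hm n (Nat.lt_succ_self n)), ?_⟩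
    rw [pow_succ] at hf
    convert hf using 2
    ring

lemma eta_distortion {K a b : ℝ} (hK : 0 < K) (ha : 0 < a) (hb : 0 < b) :
    IsDistortion (fun t => Real.sqrt (K * (t ^ a + t ^ b))) := by
  have hc : Continuous (fun t : ℝ => Real.sqrt (K * (t ^ a + t ^ b))) := by
    have h1 := Real.continuous_rpow_const ha.le
    have h2 := Real.continuous_rpow_const hb.le
    fun_prop
  refine ⟨?_, hc.continuousOn, ?_⟩
  · intro x hx y hy hxy
    have hx : 0 ≤ x := hx
    apply Real.sqrt_lt_sqrt
    · have := Real.rpow_nonneg hx a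
      have := Real.rpow_nonneg hx b
      positivity
    · have := Real.rpow_lt_rpow hx hxy ha
      have := Real.rpow_lt_rpow hx hxy hb
      gcongr
  · apply Subset.antisymm
    · rintro _ ⟨t, _, rfl⟩
      exact Real.sqrt_nonneg _
    · intro y hy
      have hy : 0 ≤ y := hy
      set T := (y ^ 2 / K) ^ a⁻¹ with hT
      have hT0 : 0 ≤ T := by positivity
      have h1 : T ^ a = y ^ 2 / K := Real.rpow_inv_rpow (by positivity) ha.ne'
      have h2 := intermediate_value_Icc hT0 hc.continuousOn
      obtain ⟨t, ht, he⟩ := h2 (show y ∈ Set.Icc _ _ by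
        constructor
        · simp [Real.zero_rpow ha.ne', Real.zero_rpow hb.ne', hy]
        · apply Real.le_sqrt_of_sq_le
          have : 0 ≤ T ^ b := by positivity
          rw [h1]
          have : K * (y ^ 2 / K) = y ^ 2 := by field_simp
          nlinarith)
      exact ⟨t, ht.1, he⟩

lemma hW_nonneg (w : EuclideanSpace ℝ (Fin 2) → ℝ) (x y) : 0 ≤ hW w x y := Real.sqrt_nonneg _

lemma hW_comm (w : EuclideanSpace ℝ (Fin 2) → ℝ) (x y) : hW w x y = hW w y x := by
  rw [hW, hW, midpoint_comm, dist_comm]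

lemma hW_sq (w : EuclideanSpace ℝ (Fin 2) → ℝ) (x y) :
    hW w x y ^ 2 = VW w (midpoint ℝ x y) (dist x y / 2) :=
  Real.sq_sqrt ENNReal.toReal_nonneg

lemma dhW_bdd (w : EuclideanSpace ℝ (Fin 2) → ℝ) (x y) :
    BddBelow {t : ℝ | ∃ (N : ℕ) (c : ℕ → EuclideanSpace ℝ (Fin 2)), c 0 = x ∧ c N = y ∧
    t = ∑ i ∈ Finset.range N, hW w (c i) (c (i + 1))} := by
  refine ⟨0, ?_⟩
  rintro _ ⟨N, c, _, _, rfl⟩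
  exact Finset.sum_nonneg fun i _ => hW_nonneg _ _ _

lemma dhW_le_chain (w : EuclideanSpace ℝ (Fin 2) → ℝ) (N : ℕ)
    (c : ℕ → EuclideanSpace ℝ (Fin 2)) :
    dhW w (c 0) (c N) ≤ ∑ i ∈ Finset.range N, hW w (c i) (c (i + 1)) :=
  csInf_le (dhW_bdd w _ _) ⟨N, c, rfl, rfl, rfl⟩

lemma dhW_nonneg (w : EuclideanSpace ℝ (Fin 2) → ℝ) (x y) : 0 ≤ dhW w x y := by
  apply Real.sInf_nonneg
  rintro _ ⟨N, c, _, _, rfl⟩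
  exact Finset.sum_nonneg fun i _ => hW_nonneg _ _ _

lemma dhW_le_hW (w : EuclideanSpace ℝ (Fin 2) → ℝ) (x y) : dhW w x y ≤ hW w x y := by
  have := dhW_le_chain w 1 (fun n => if n = 0 then x else y)
  simpa using this

lemma dhW_self (w : EuclideanSpace ℝ (Fin 2) → ℝ) (x) : dhW w x x = 0 := by
  have := dhW_le_chain w 0 (fun _ => x)
  exact le_antisymm (by simpa using this) (dhW_nonneg _ _ _)

lemma exists_chain_lt (w : EuclideanSpace ℝ (Fin 2) → ℝ) (x y) (t : ℝ) (ht : dhW w x y < t) :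
    ∃ (N : ℕ) (c : ℕ → EuclideanSpace ℝ (Fin 2)), c 0 = x ∧ c N = y ∧
      ∑ i ∈ Finset.range N, hW w (c i) (c (i + 1)) < t := by
  have hne : {t : ℝ | ∃ (N : ℕ) (c : ℕ → EuclideanSpace ℝ (Fin 2)), c 0 = x ∧ c N = y ∧
      t = ∑ i ∈ Finset.range N, hW w (c i) (c (i + 1))}.Nonempty :=
    ⟨_, 1, (fun n => if n = 0 then x else y), by simp, by simp, rfl⟩
  obtain ⟨_, ⟨N, c, h0, hN, rfl⟩, hlt⟩ := exists_lt_of_csInf_lt hne ht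
  exact ⟨N, c, h0, hN, hlt⟩

lemma dhW_comm_le (w : EuclideanSpace ℝ (Fin 2) → ℝ) (x y) : dhW w x y ≤ dhW w y x := by
  refine le_of_forall_gt_imp_ge_of_dense fun t ht => ?_
  obtain ⟨N, c, rfl, rfl, hlt⟩ := exists_chain_lt w _ _ _ ht
  have h := dhW_le_chain w N (fun i => c (N - i))
  simp only [Nat.sub_zero, Nat.sub_self] at h
  refine h.trans (le_trans (le_of_eq ?_) hlt.le)
  rw [← Finset.sum_range_reflect]
  refine Finset.sum_congr rfl fun i hi => ?_
  have hi := Finset.mem_range.mp hi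
  rw [hW_comm]
  congr 2 <;> omega

lemma dhW_triangle (w : EuclideanSpace ℝ (Fin 2) → ℝ) (x y z) :
    dhW w x z ≤ dhW w x y + dhW w y z := by
  refine le_of_forall_pos_le_add fun ε hε => ?_
  obtain ⟨N, c, h0, hN, hlt⟩ := exists_chain_lt w x y (dhW w x y + ε / 2) (by linarith)
  obtain ⟨M, c', h0', hM, hlt'⟩ := exists_chain_lt w y z (dhW w y z + ε / 2) (by linarith)
  have h := dhW_le_chain w (N + M) (fun i => if i < N then c i else c' (i - N))
  have e0 : (if 0 < N then c 0 else c' (0 - N)) = x := by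
    split_ifs with hh
    · exact h0
    · have : N = 0 := by omega
      subst this
      rw [Nat.sub_zero, h0', ← hN, h0]
  have e1 : (if N + M < N then c (N + M) else c' (N + M - N)) = z := by
    rw [if_neg (by omega), Nat.add_sub_cancel_left, hM]
  simp only [e0, e1] at h
  rw [Finset.sum_range_add] at h
  have s1 : ∑ i ∈ Finset.range N, hW w (if i < N then c i else c' (i - N))
      (if i + 1 < N then c (i + 1) else c' (i + 1 - N)) =
      ∑ i ∈ Finset.range N, hW w (c i) (c (i + 1)) := by
    refine Finset.sum_congr rfl fun i hi => ?_
    have hi := Finset.mem_range.mp hi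
    rw [if_pos hi]
    split_ifs with hh
    · rfl
    · have : i + 1 = N := by omega
      rw [this, Nat.sub_self, h0', hN]
  have s2 : ∑ i ∈ Finset.range M, hW w (if N + i < N then c (N + i) else c' (N + i - N))
      (if N + i + 1 < N then c (N + i + 1) else c' (N + i + 1 - N)) =
      ∑ i ∈ Finset.range M, hW w (c' i) (c' (i + 1)) := by
    refine Finset.sum_congr rfl fun i hi => ?_
    rw [if_neg (by omega), if_neg (by omega), Nat.add_sub_cancel_left, add_assoc,
      Nat.add_sub_cancel_left]
  rw [s1, s2] at h
  linarith

lemma hW_sq_le (w : EuclideanSpace ℝ (Fin 2) → ℝ)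
    (hloc : MeasureTheory.LocallyIntegrable w volume) (x y) :
    hW w x y ^ 2 ≤ VW w x (dist x y) := by
  rw [hW_sq]
  apply VW_mono w hloc
  apply Metric.ball_subset_ball'
  rw [dist_midpoint_left]
  simp
  linarith

lemma le_hW_sq (w : EuclideanSpace ℝ (Fin 2) → ℝ)
    (hloc : MeasureTheory.LocallyIntegrable w volume) {D : ℝ} (hD : 2 ≤ D)
    (hd : ∀ x r, 0 < r → VW w x (2 * r) ≤ D * VW w x r) (x y) :
    VW w x (dist x y) ≤ D ^ 2 * hW w x y ^ 2 := by
  rcases eq_or_ne x y with rfl | hxy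
  · simp only [dist_self, VW, Metric.ball_zero, measure_empty, ENNReal.toReal_zero]
    positivity
  have hp := dist_pos.mpr hxy
  rw [hW_sq]
  have h1 := hd (midpoint ℝ x y) (dist x y / 2) (by linarith)
  have h2 := hd (midpoint ℝ x y) (2 * (dist x y / 2)) (by linarith)
  have h3 : VW w x (dist x y) ≤ VW w (midpoint ℝ x y) (2 * (2 * (dist x y / 2))) := by
    apply VW_mono w hloc
    apply Metric.ball_subset_ball'
    rw [dist_left_midpoint]
    simp
    linarith
  have h4 := mul_le_mul_of_nonneg_left h1 (show 0 ≤ D by linarith)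
  linarith [show D * (D * VW w (midpoint ℝ x y) (dist x y / 2)) =
    D ^ 2 * VW w (midpoint ℝ x y) (dist x y / 2) by ring]

/-- Proposition 4.10 (one direction): a strong-A∞ weight `w` on `ℝ²` (i.e. `dμ = w·dm` is
doubling, A∞-related to Lebesgue measure `m`, and `d_h ≥ C⁻¹ h`) induces a metric `d_h`
quasisymmetric to the Euclidean metric with `μ(B_{d_h}(x,r)) ≍ r²`. -/
theorem strong_Ainfty_gives_metric
    (w : EuclideanSpace ℝ (Fin 2) → ℝ)
    (hw0 : ∀ x, 0 ≤ w x) (hwmeas : Measurable w)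
    (hloc : MeasureTheory.LocallyIntegrable w volume)
    (hVD : VDFor (fun x y : EuclideanSpace ℝ (Fin 2) => dist x y) (muW w))
    (hA : AInftyFor (fun x y : EuclideanSpace ℝ (Fin 2) => dist x y) volume (muW w))
    (hstrong : ∃ C : ℝ, 0 < C ∧ ∀ x y : EuclideanSpace ℝ (Fin 2),
      C⁻¹ * hW w x y ≤ dhW w x y) :
    IsMetricOn (EuclideanSpace ℝ (Fin 2)) (dhW w) ∧
      (∃ η : ℝ → ℝ, IsDistortion η ∧
        QuasisymmetricWith η (fun x y : EuclideanSpace ℝ (Fin 2) => dist x y) (dhW w)) ∧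
      ∃ C₁ : ℝ, 1 < C₁ ∧ ∀ (x : EuclideanSpace ℝ (Fin 2)) (r : ℝ), 0 < r →
        ENNReal.ofReal (C₁⁻¹ * r ^ 2) ≤ muW w (mball (dhW w) x r) ∧
          muW w (mball (dhW w) x r) ≤ ENNReal.ofReal (C₁ * r ^ 2) := by
  obtain ⟨C, hC, hst⟩ := hstrong
  obtain ⟨D, hD, hd⟩ := VW_doubling w hloc hVD
  obtain ⟨τ, hτ0, hτ1, hrv⟩ := VW_reverse w hloc hA
  have hmono : ∀ x, Monotone (VW w x) := fun x r s hrs =>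
    VW_mono w hloc (Metric.ball_subset_ball hrs)
  have hpos := fun x r (hr : 0 < r) => VW_pos w hloc hA x hr
  have hzero : ∀ x, VW w x 0 = 0 := fun x => by simp [VW]
  have hhC : ∀ x y, hW w x y ≤ C * dhW w x y := fun x y => by
    have := hst x y
    rwa [inv_mul_le_iff₀ hC] at this
  have hVd : ∀ x y, VW w x (dist x y) ≤ D ^ 2 * C ^ 2 * dhW w x y ^ 2 := fun x y => by
    have h1 := le_hW_sq w hloc hD hd x y
    have h2 : hW w x y ^ 2 ≤ (C * dhW w x y) ^ 2 :=
      pow_le_pow_left₀ (hW_nonneg _ _ _) (hhC x y) 2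
    calc _ ≤ D ^ 2 * hW w x y ^ 2 := h1
      _ ≤ D ^ 2 * (C * dhW w x y) ^ 2 := by gcongr
      _ = _ := by ring
  have hdV : ∀ x y, dhW w x y ^ 2 ≤ VW w x (dist x y) := fun x y =>
    (pow_le_pow_left₀ (dhW_nonneg _ _ _) (dhW_le_hW w x y) 2).trans (hW_sq_le w hloc x y)
  refine ⟨⟨dhW_nonneg w, ?_, ?_, dhW_triangle w⟩, ?_, ?_⟩
  · intro x y
    refine ⟨fun h => ?_, fun h => h ▸ dhW_self w x⟩
    by_contra hne
    have h1 := hVd x y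
    have h2 := hpos x _ (dist_pos.mpr hne)
    rw [h] at h1
    simp at h1
    linarith
  · exact fun x y => le_antisymm (dhW_comm_le w x y) (dhW_comm_le w y x)
  · refine ⟨_, eta_distortion (K := D * 4 * (D ^ 2 * C ^ 2)) (a := Real.logb τ (1 / 4))
      (b := Real.logb 2 D) (by positivity)
      (Real.logb_pos_of_base_lt_one hτ0 hτ1 (by norm_num) (by norm_num))
      (Real.logb_pos (by norm_num) (by linarith)), ?_⟩
    intro x u v hxv
    have hp := dist_pos.mpr hxv
    have ht : 0 ≤ dist x u / dist x v := by positivity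
    have h1 := growth (VW w x) (hmono x) (hpos x) (hzero x) hD hτ0 hτ1 (hd x) (hrv x)
      (dist x u / dist x v) (dist x v) ht hp
    rw [div_mul_cancel₀ _ hp.ne'] at h1
    have e1 := Real.rpow_nonneg ht (Real.logb τ (1 / 4))
    have e2 := Real.rpow_nonneg ht (Real.logb 2 D)
    have e3 := add_nonneg e1 e2
    beta_reduce
    set S := (dist x u / dist x v) ^ Real.logb τ (1 / 4) +
      (dist x u / dist x v) ^ Real.logb 2 D with hS
    have h2 : dhW w x u ^ 2 ≤ D * 4 * (D ^ 2 * C ^ 2) * S * dhW w x v ^ 2 := by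
      calc _ ≤ _ := hdV x u
        _ ≤ _ := h1
        _ ≤ D * 4 * S * (D ^ 2 * C ^ 2 * dhW w x v ^ 2) := by
          gcongr
          exact hVd x v
        _ = _ := by ring
    refine (sq_le_sq₀ (dhW_nonneg _ _ _) (mul_nonneg (Real.sqrt_nonneg _) (dhW_nonneg _ _ _))).mp ?_
    rw [mul_pow, Real.sq_sqrt (by positivity)]
    exact h2
  · set A := D ^ 2 * C ^ 2 with hA'
    have hA0 : 0 < A := by positivity
    refine ⟨2 * D + D * A, by nlinarith [mul_pos (show 0 < D by linarith) hA0], fun x r hr => ⟨?_, ?_⟩⟩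
    · obtain ⟨ρ, hρ, h1, h2⟩ := scale (VW w x) (hmono x) (hpos x) hτ0 (hrv x) (r ^ 2 / 2)
        (by positivity)
      have hsub : Metric.ball x ρ ⊆ mball (dhW w) x r := by
        intro y hy
        rw [Metric.mem_ball, dist_comm] at hy
        have h3 := (hdV x y).trans (hmono x hy.le)
        show dhW w x y < r
        exact lt_of_pow_lt_pow_left₀ 2 hr.le (by nlinarith [pow_pos hr 2])
      refine le_trans ?_ (measure_mono hsub)
      apply ENNReal.ofReal_le_of_le_toReal
      change _ ≤ VW w x ρ
      have h4 := hd x ρ hρ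
      have hDA : 0 < 2 * D + D * A := by positivity
      rw [inv_mul_le_iff₀ hDA]
      have := mul_nonneg (mul_nonneg (show 0 ≤ D by linarith) hA0.le) (hpos x ρ hρ).le
      nlinarith
    · obtain ⟨ρ, hρ, h1, h2⟩ := scale (VW w x) (hmono x) (hpos x) hτ0 (hrv x) (A * r ^ 2)
        (by positivity)
      have hsub : mball (dhW w) x r ⊆ Metric.ball x (2 * ρ) := by
        intro y hy
        have hy : dhW w x y < r := hy
        rw [Metric.mem_ball, dist_comm]
        by_contra hcon
        have h3 := hmono x (not_lt.mp hcon)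
        have h4 := hVd x y
        have h5 : dhW w x y ^ 2 ≤ r ^ 2 := pow_le_pow_left₀ (dhW_nonneg _ _ _) hy.le 2
        have h6 := mul_le_mul_of_nonneg_left h5 hA0.le
        linarith
      refine (measure_mono hsub).trans ?_
      rw [← ENNReal.ofReal_toReal (muW_ball_lt_top w hloc x (2 * ρ)).ne]
      apply ENNReal.ofReal_le_ofReal
      change VW w x (2 * ρ) ≤ _
      have h4 := hd x ρ hρ
      have h5 := mul_le_mul_of_nonneg_left h1 (show 0 ≤ D by linarith)
      have : 0 ≤ 2 * D * r ^ 2 := by positivity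
      nlinarith
end
end

section
/- Let (K,d) be a compact metric space, let η be a distortion function, and let 0 < c₁ ≤ c₂ < ∞. Let (θ_n)_{n∈ℕ} be a sequence of metrics on K, each η-quasisymmetric to d, with c₁ ≤ diam(K,θ_n) ≤ c₂ for every n. Then there exist a subsequence (θ_{n_k}) and a metric θ on K such that θ_{n_k} → θ uniformly on K × K and θ is η-quasisymmetric to d. -/
open Metric Set Filter Topology

noncomputable section

/-- Arzelà–Ascoli-type compactness for quasisymmetric metrics on a compact metric space:
a sequence of metrics `θₙ` on a compact space `(K,d)`, each `η`-quasisymmetric to `d` and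
with diameters bounded between `c₁` and `c₂`, has a subsequence converging uniformly on
`K × K` to a metric `θ` which is again `η`-quasisymmetric to `d`. -/
theorem quasisymmetric_metrics_compactness
    (K : Type) [MetricSpace K] [CompactSpace K]
    (η : ℝ → ℝ) (hη : IsDistortion η)
    (c₁ c₂ : ℝ) (hc₁ : 0 < c₁) (hc₁₂ : c₁ ≤ c₂)
    (θ : ℕ → K → K → ℝ)
    (hmet : ∀ n : ℕ, IsMetricOn K (θ n))
    (hqs : ∀ n : ℕ, QuasisymmetricWith η (fun x y : K => dist x y) (θ n))
    (hdiam : ∀ n : ℕ, c₁ ≤ diamWith (θ n) (Set.univ : Set K) ∧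
      diamWith (θ n) (Set.univ : Set K) ≤ c₂) :
    ∃ (φ : ℕ → ℕ) (θL : K → K → ℝ), StrictMono φ ∧
      IsMetricOn K θL ∧
      QuasisymmetricWith η (fun x y : K => dist x y) θL ∧
      TendstoUniformly (fun (k : ℕ) (p : K × K) => θ (φ k) p.1 p.2)
        (fun p : K × K => θL p.1 p.2) Filter.atTop := by
  obtain ⟨hmono, hcont, himg⟩ := hη
  have hη0 : η 0 = 0 := by
    have h0 : (0 : ℝ) ∈ η '' Set.Ici 0 := by rw [himg]; exact Set.self_mem_Ici
    obtain ⟨t, ht, hte⟩ := h0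
    have h1 : η 0 ≤ η t := hmono.monotoneOn Set.self_mem_Ici ht ht
    have h2 : η 0 ∈ Set.Ici (0 : ℝ) := by
      rw [← himg]; exact ⟨0, Set.self_mem_Ici, rfl⟩
    exact le_antisymm (hte ▸ h1) h2
  have hmon : ∀ s t : ℝ, 0 ≤ s → s ≤ t → η s ≤ η t := fun s t hs hst =>
    hmono.monotoneOn hs (hs.trans hst) hst
  have hbdd : ∀ n, BddAbove (Set.image2 (θ n) Set.univ Set.univ) := by
    intro n
    by_contra h
    have h1 := (hdiam n).1
    rw [diamWith, Real.sSup_of_not_bddAbove h] at h1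
    linarith
  have hub : ∀ n x y, θ n x y ≤ c₂ := fun n x y =>
    (le_csSup (hbdd n) ⟨x, trivial, y, trivial, rfl⟩).trans (hdiam n).2
  have hbig : ∀ n, ∃ u v, c₁ / 2 < θ n u v := by
    intro n
    have hne : (Set.image2 (θ n) Set.univ Set.univ).Nonempty := by
      by_contra h
      rw [Set.not_nonempty_iff_eq_empty] at h
      have h1 := (hdiam n).1
      rw [diamWith, h, Real.sSup_empty] at h1
      linarith
    obtain ⟨_, ⟨u, _, v, _, rfl⟩, h⟩ := exists_lt_of_lt_csSup hne
      (show c₁ / 2 < sSup (Set.image2 (θ n) Set.univ Set.univ) by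
        have := (hdiam n).1
        rw [diamWith] at this
        linarith)
    exact ⟨u, v, h⟩
  have hlow : ∀ n x y, x ≠ y →
      c₁ / 4 ≤ η (Metric.diam (Set.univ : Set K) / dist x y) * θ n x y := by
    intro n x y hxy
    have hw : ∃ w, c₁ / 4 ≤ θ n x w := by
      obtain ⟨u, v, h⟩ := hbig n
      by_contra! hc
      have h1 := hc u
      have h2 := hc v
      have h3 := (hmet n).2.2.2 u x v
      have h4 := (hmet n).2.2.1 u x
      linarith
    obtain ⟨w, hw⟩ := hw
    refine hw.trans ((hqs n x w y hxy).trans ?_)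
    refine mul_le_mul_of_nonneg_right (hmon _ _ (by positivity) ?_) ((hmet n).1 x y)
    have := Metric.dist_le_diam_of_mem (isCompact_univ (X := K)).isBounded
      (Set.mem_univ x) (Set.mem_univ w)
    show dist x w / dist x y ≤ _
    gcongr
  -- two distinct points
  obtain ⟨a, b, hab⟩ : ∃ a b : K, a ≠ b := by
    obtain ⟨u, v, h⟩ := hbig 0
    refine ⟨u, v, fun huv => ?_⟩
    have := ((hmet 0).2.1 u v).2 huv
    linarith
  have hab0 : 0 < dist a b := dist_pos.2 hab
  have hc₂ : 0 < c₂ := hc₁.trans_le hc₁₂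
  have hmod : ∀ n x u, θ n x u ≤ η (dist x u / (dist a b / 2)) * c₂ := by
    intro n x u
    have hv : ∃ v, dist a b / 2 ≤ dist x v := by
      by_contra! hc
      have h1 := hc a
      have h2 := hc b
      have h3 := dist_triangle_left a b x
      linarith
    obtain ⟨v, hv⟩ := hv
    have hxv : x ≠ v := by
      intro h
      rw [h, dist_self] at hv
      linarith
    have h1 : η (dist x u / dist x v) ≤ η (dist x u / (dist a b / 2)) :=
      hmon _ _ (by positivity) (by gcongr)
    have h0 : 0 ≤ η (dist x u / (dist a b / 2)) := by
      rw [← hη0]; exact hmon _ _ le_rfl (by positivity)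
    exact (hqs n x u v hxv).trans
      (mul_le_mul h1 (hub n x v) ((hmet n).1 x v) h0)
  have hsmall : ∀ ε > 0, ∃ δ > 0, ∀ n x u, dist x u < δ → θ n x u < ε := by
    intro ε hε
    have h1 := Metric.continuousWithinAt_iff.1 (hcont 0 Set.self_mem_Ici) (ε / c₂) (by positivity)
    obtain ⟨δ, hδ, h⟩ := h1
    refine ⟨δ * (dist a b / 2), by positivity, fun n x u hxu => (hmod n x u).trans_lt ?_⟩
    have hp : 0 ≤ dist x u / (dist a b / 2) := by positivity
    have h2 := h (x := dist x u / (dist a b / 2)) hp (by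
      rw [Real.dist_eq, sub_zero, abs_of_nonneg hp, div_lt_iff₀ (by positivity)]
      exact hxu)
    rw [hη0, Real.dist_eq, sub_zero] at h2
    exact (lt_div_iff₀ hc₂).1 ((le_abs_self _).trans_lt h2)
  have hequi : UniformEquicontinuous (fun (n : ℕ) (p : K × K) => θ n p.1 p.2) := by
    rw [Metric.uniformEquicontinuous_iff]
    intro ε hε
    obtain ⟨δ, hδ, h⟩ := hsmall (ε / 2) (by positivity)
    refine ⟨δ, hδ, fun p q hpq n => ?_⟩
    rw [Prod.dist_eq, max_lt_iff] at hpq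
    have h1 := h n _ _ hpq.1
    have h2 := h n _ _ hpq.2
    obtain ⟨_, _, hs, ht⟩ := hmet n
    rw [Real.dist_eq, abs_lt]
    have t1 := ht p.1 q.1 p.2
    have t2 := ht q.1 q.2 p.2
    have t3 := ht q.1 p.1 q.2
    have t4 := ht p.1 p.2 q.2
    have s1 := hs q.1 p.1
    have s2 := hs q.2 p.2
    constructor <;> linarith
  let F : ℕ → BoundedContinuousFunction (K × K) ℝ := fun n =>
    BoundedContinuousFunction.mkOfCompact
      ⟨fun p => θ n p.1 p.2, (hequi.uniformContinuous n).continuous⟩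
  have hF : ∀ n p, F n p = θ n p.1 p.2 := fun n p => rfl
  have hcpt : IsCompact (closure (Set.range F)) := by
    refine BoundedContinuousFunction.arzela_ascoli (Set.Icc 0 c₂) isCompact_Icc _ ?_ ?_
    · rintro f p ⟨n, rfl⟩
      exact ⟨(hmet n).1 _ _, hub n _ _⟩
    · have he := hequi.equicontinuous
      intro p U hU
      filter_upwards [he p U hU] with q hq
      rintro ⟨_, n, rfl⟩
      exact hq n
  obtain ⟨f, _, φ, hφ, hlim⟩ := hcpt.tendsto_subseq (x := F)
    (fun n => subset_closure ⟨n, rfl⟩)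
  have hunif := BoundedContinuousFunction.tendsto_iff_tendstoUniformly.1 hlim
  have hpt : ∀ x y, Tendsto (fun k => θ (φ k) x y) atTop (𝓝 (f (x, y))) := fun x y =>
    hunif.tendsto_at (x, y)
  refine ⟨φ, fun x y => f (x, y), hφ, ⟨?_, ?_, ?_, ?_⟩, ?_, hunif⟩
  · exact fun x y => ge_of_tendsto' (hpt x y) fun k => (hmet _).1 x y
  · intro x y
    constructor
    · intro h0
      by_contra hxy
      have h1 := ge_of_tendsto' ((hpt x y).const_mul
        (η (Metric.diam (Set.univ : Set K) / dist x y))) fun k => hlow (φ k) x y hxy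
      have h0' : f (x, y) = 0 := h0
      rw [h0', mul_zero] at h1
      linarith
    · rintro rfl
      refine tendsto_nhds_unique (hpt x x) ?_
      have : (fun k => θ (φ k) x x) = fun _ => 0 := by
        funext k
        exact ((hmet _).2.1 x x).2 rfl
      rw [this]
      exact tendsto_const_nhds
  · intro x y
    refine tendsto_nhds_unique (hpt x y) ?_
    exact (hpt y x).congr fun k => (hmet _).2.2.1 y x
  · intro x y z
    exact le_of_tendsto_of_tendsto' (hpt x z) ((hpt x y).add (hpt y z))
      fun k => (hmet _).2.2.2 x y z
  · intro x u v hxv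
    exact le_of_tendsto_of_tendsto' (hpt x u) ((hpt x v).const_mul _)
      fun k => hqs (φ k) x u v hxv
end
end

section
/- Let (X,d) be a complete, K_D-doubling, K_P-uniformly perfect, unbounded metric space, let x₀ ∈ X, and let η be a distortion function. Let (θ_n)_{n∈ℕ} be a sequence of metrics on X, each η-quasisymmetric to d, normalized so that diam(B_d(x₀,1), θ_n) = 1 for every n, where B_d(x₀,1) is the open d-ball of radius 1 about x₀. Then there exist a subsequence (θ_{n_k}) and a metric θ on X such that θ_{n_k} → θ uniformly on C × C for every compact subset C of X, and θ is η-quasisymmetric to d. -/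
open Metric Set Filter Topology
open scoped ENNReal

noncomputable section

theorem aux_proper (X : Type) [MetricSpace X] [CompleteSpace X] (KD : ℝ)
    (hdoub : IsDoublingWith X KD) : ProperSpace X := by
  have key : ∀ (k : ℕ) (x : X) (r : ℝ), 0 < r → ∃ t : Set X, t.Finite ∧
      Metric.ball x r ⊆ ⋃ y ∈ t, Metric.ball y (r / 2 ^ k) := by
    intro k
    induction k with
    | zero =>
      intro x r hr
      exact ⟨{x}, Set.finite_singleton x, by simp⟩
    | succ k ih =>
      intro x r hr
      obtain ⟨t, ht, hs⟩ := ih x r hr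
      choose s hs1 hs2 using fun y : X => hdoub y (r / 2 ^ k) (by positivity)
      refine ⟨⋃ y ∈ t, (s y : Set X), ht.biUnion fun y _ => (s y).finite_toSet, ?_⟩
      intro z hz
      obtain ⟨y, hy, hzy⟩ := Set.mem_iUnion₂.1 (hs hz)
      obtain ⟨w, hw, hzw⟩ := Set.mem_iUnion₂.1 (hs2 y hzy)
      refine Set.mem_iUnion₂.2 ⟨w, Set.mem_iUnion₂.2 ⟨y, hy, hw⟩, ?_⟩
      have : r / 2 ^ k / 2 = r / 2 ^ (k + 1) := by rw [pow_succ, div_div]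
      rwa [this] at hzw
  refine ⟨fun x r => ?_⟩
  refine TotallyBounded.isCompact_of_isClosed ?_ Metric.isClosed_closedBall
  rw [Metric.totallyBounded_iff]
  intro ε hε
  have hR : 0 < |r| + 1 := by positivity
  obtain ⟨k, hk⟩ := exists_pow_lt_of_lt_one (div_pos hε hR) (by norm_num : (1 / 2 : ℝ) < 1)
  obtain ⟨t, ht, hs⟩ := key k x (|r| + 1) hR
  refine ⟨t, ht, ?_⟩
  have h1 : Metric.closedBall x r ⊆ Metric.ball x (|r| + 1) :=
    Metric.closedBall_subset_ball (by linarith [le_abs_self r])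
  refine (h1.trans hs).trans (Set.iUnion₂_mono fun y _ => Metric.ball_subset_ball ?_)
  rw [lt_div_iff₀ hR] at hk
  rw [one_div, inv_pow] at hk
  rw [div_eq_inv_mul]
  exact hk.le

theorem aux_ascoli (Y : Type) [MetricSpace Y] [ProperSpace Y] (F : ℕ → Y → ℝ)
    (M : Y → ℝ) (b : Y → Y → ℝ) (hM : ∀ n p, F n p ∈ Set.Icc 0 (M p))
    (hb : ∀ n p q, |F n p - F n q| ≤ b p q)
    (hb0 : ∀ p, Tendsto (b p) (𝓝 p) (𝓝 0)) :
    ∃ (φ : ℕ → ℕ) (g : Y → ℝ), StrictMono φ ∧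
      ∀ C : Set Y, IsCompact C → TendstoUniformlyOn (fun k p => F (φ k) p) g atTop C := by
  let T : Set (Y → ℝ) := {f | (∀ p, f p ∈ Set.Icc 0 (M p)) ∧ ∀ p q, |f p - f q| ≤ b p q}
  have hTc : ∀ f ∈ T, Continuous f := by
    intro f hf
    rw [continuous_iff_continuousAt]
    intro p
    rw [ContinuousAt, tendsto_iff_dist_tendsto_zero]
    refine squeeze_zero (fun _ => dist_nonneg) (fun q => ?_) (hb0 p)
    rw [dist_comm, Real.dist_eq]
    exact hf.2 p q
  have hTcomp : IsCompact T := by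
    refine IsCompact.of_isClosed_subset
      (isCompact_univ_pi (fun p : Y => isCompact_Icc (a := (0 : ℝ)) (b := M p))) ?_ ?_
    · have : T = (⋂ p, {f : Y → ℝ | f p ∈ Set.Icc 0 (M p)}) ∩
          ⋂ p, ⋂ q, {f : Y → ℝ | |f p - f q| ≤ b p q} := by
        ext f; simp [T]
      rw [this]
      refine IsClosed.inter (isClosed_iInter fun p => ?_)
        (isClosed_iInter fun p => isClosed_iInter fun q => ?_)
      · exact isClosed_Icc.preimage (continuous_apply p)
      · exact isClosed_le (by fun_prop) continuous_const
    · intro f hf p _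
      exact hf.1 p
  let S : Set C(Y, ℝ) := {f | (f : Y → ℝ) ∈ T}
  have hS : IsCompact S := by
    refine ArzelaAscoli.isCompact_of_equicontinuous S ?_ ?_
    · convert hTcomp
      ext f
      constructor
      · rintro ⟨g, hg, rfl⟩
        exact hg
      · intro hf
        exact ⟨⟨f, hTc f hf⟩, hf, rfl⟩
    · intro p
      refine Metric.equicontinuousAt_of_continuity_modulus (b p) (hb0 p) _ ?_
      refine Eventually.of_forall fun q f => ?_
      rw [Real.dist_eq]
      exact f.2.2 p q
  have hFT : ∀ n, F n ∈ T := fun n => ⟨hM n, hb n⟩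
  let G : ℕ → C(Y, ℝ) := fun n => ⟨F n, hTc _ (hFT n)⟩
  obtain ⟨g, _, φ, hφ, hlim⟩ := hS.isSeqCompact (x := G) (fun n => hFT n)
  refine ⟨φ, g, hφ, ?_⟩
  exact ContinuousMap.tendsto_iff_forall_isCompact_tendstoUniformlyOn.1 hlim

/-- Local compactness of normalized quasisymmetric metrics on a complete, doubling, uniformly
perfect, unbounded metric space: a sequence of metrics `θₙ`, each `η`-quasisymmetric to `d`
and normalized by `diam(B_d(x₀,1),θₙ) = 1`, has a subsequence converging uniformly on
`C × C` for every compact `C ⊆ X`, to a metric `θ` that is `η`-quasisymmetric to `d`. -/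
theorem quasisymmetric_metrics_compactness_noncompact
    (X : Type) [MetricSpace X] [CompleteSpace X]
    (KD KP : ℝ) (hKD : 1 ≤ KD) (hKP : 1 < KP)
    (hdoub : IsDoublingWith X KD) (hperf : IsUniformlyPerfectWith X KP)
    (hunbdd : EMetric.diam (Set.univ : Set X) = ⊤)
    (x₀ : X) (η : ℝ → ℝ) (hη : IsDistortion η)
    (θ : ℕ → X → X → ℝ)
    (hmet : ∀ n : ℕ, IsMetricOn X (θ n))
    (hqs : ∀ n : ℕ, QuasisymmetricWith η (fun x y : X => dist x y) (θ n))
    (hnorm : ∀ n : ℕ, diamWith (θ n) (Metric.ball x₀ 1) = 1) :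
    ∃ (φ : ℕ → ℕ) (θL : X → X → ℝ), StrictMono φ ∧
      IsMetricOn X θL ∧
      QuasisymmetricWith η (fun x y : X => dist x y) θL ∧
      ∀ C : Set X, IsCompact C →
        TendstoUniformlyOn (fun (k : ℕ) (p : X × X) => θ (φ k) p.1 p.2)
          (fun p : X × X => θL p.1 p.2) Filter.atTop (C ×ˢ C) := by
  haveI := aux_proper X KD hdoub
  obtain ⟨hmono, hcont, himg⟩ := hη
  have hη_nn : ∀ t, 0 ≤ t → 0 ≤ η t := by
    intro t ht
    have : η t ∈ η '' Set.Ici 0 := ⟨t, ht, rfl⟩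
    rw [himg] at this
    exact this
  have hη0 : η 0 = 0 := by
    have : (0 : ℝ) ∈ η '' Set.Ici 0 := by rw [himg]; exact Set.self_mem_Ici
    obtain ⟨s, hs, hs0⟩ := this
    have h1 : η 0 ≤ η s := hmono.monotoneOn Set.self_mem_Ici hs hs
    have h2 := hη_nn 0 le_rfl
    linarith
  have hηm : ∀ s t, 0 ≤ s → s ≤ t → η s ≤ η t := fun s t hs hst =>
    hmono.monotoneOn hs (hs.trans hst : (0 : ℝ) ≤ t) hst
  have hθnn : ∀ n x y, 0 ≤ θ n x y := fun n => (hmet n).1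
  have hθs : ∀ n x y, θ n x y = θ n y x := fun n => (hmet n).2.2.1
  have hθt : ∀ n x y z, θ n x z ≤ θ n x y + θ n y z := fun n => (hmet n).2.2.2
  have hθ0 : ∀ n x, θ n x x = 0 := fun n x => ((hmet n).2.1 x x).2 rfl
  -- a reference point
  obtain ⟨p, hpB, hp⟩ : ∃ p ∈ Metric.ball x₀ 1, x₀ ≠ p := by
    have hne : ((Metric.ball x₀ 1)ᶜ).Nonempty := by
      rw [Set.nonempty_compl]
      intro h
      have hb : Bornology.IsBounded (Set.univ : Set X) := h ▸ Metric.isBounded_ball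
      exact hb.ediam_ne_top hunbdd
    obtain ⟨p, hp1, hp2⟩ := hperf x₀ 1 one_pos hne
    refine ⟨p, hp1, ?_⟩
    rintro rfl
    exact hp2 (Metric.mem_ball_self (by positivity))
  have hD : 0 < dist x₀ p := dist_pos.2 hp
  -- upper bound on the unit ball
  have hbdd : ∀ n, BddAbove (Set.image2 (θ n) (Metric.ball x₀ 1) (Metric.ball x₀ 1)) := by
    intro n
    by_contra h
    have h1 := hnorm n
    rw [diamWith, Real.sSup_of_not_bddAbove h] at h1
    exact zero_ne_one h1
  have hx₀B : x₀ ∈ Metric.ball x₀ (1 : ℝ) := Metric.mem_ball_self one_pos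
  have hle1 : ∀ n, θ n x₀ p ≤ 1 := by
    intro n
    rw [← hnorm n]
    exact le_csSup (hbdd n) ⟨x₀, hx₀B, p, hpB, rfl⟩
  let M : X → ℝ := fun x => η (dist x₀ x / dist x₀ p)
  have hMnn : ∀ x, 0 ≤ M x := fun x => hη_nn _ (by positivity)
  have hM : ∀ n x, θ n x₀ x ≤ M x := by
    intro n x
    have h1 := hqs n x₀ x p hp
    exact h1.trans (mul_le_of_le_one_right (hMnn x) (hle1 n))
  have hM2 : ∀ n x y, θ n x y ≤ M x + M y := by
    intro n x y
    have h1 := hθt n x x₀ y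
    have h2 := hM n x
    have h3 := hM n y
    rw [hθs n x x₀] at h1
    linarith
  -- lower bound
  obtain ⟨c, hc, hlow⟩ : ∃ c > 0, ∀ n, c ≤ θ n x₀ p := by
    have hA : 0 < η (1 / dist x₀ p) := by
      rw [← hη0]
      exact hmono Set.self_mem_Ici (by positivity : (0 : ℝ) ≤ 1 / dist x₀ p) (by positivity)
    refine ⟨1 / 4 / η (1 / dist x₀ p), by positivity, fun n => ?_⟩
    have hstep : ∀ a ∈ Metric.ball x₀ (1 : ℝ), θ n x₀ a ≤ η (1 / dist x₀ p) * θ n x₀ p := by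
      intro a ha
      refine (hqs n x₀ a p hp).trans (mul_le_mul_of_nonneg_right ?_ (hθnn _ _ _))
      refine hηm _ _ (by positivity) ?_
      have : dist x₀ a ≤ 1 := by rw [dist_comm]; exact (Metric.mem_ball.1 ha).le
      show dist x₀ a / dist x₀ p ≤ 1 / dist x₀ p
      gcongr
    obtain ⟨_, ⟨a, ha, b, hb, rfl⟩, hab⟩ := exists_lt_of_lt_csSup
      (s := Set.image2 (θ n) (Metric.ball x₀ 1) (Metric.ball x₀ 1)) (b := 1 / 2)
      ⟨_, x₀, hx₀B, x₀, hx₀B, rfl⟩ (by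
        have h1 := hnorm n
        rw [diamWith] at h1
        rw [h1]; norm_num)
    have h1 := hθt n a x₀ b
    rw [hθs n a x₀] at h1
    have h2 := hstep a ha
    have h3 := hstep b hb
    rw [div_le_iff₀ hA]
    linarith
  have hlow2 : ∀ x y, x ≠ y → ∃ c' > 0, ∀ n, c' ≤ θ n x y := by
    intro x y hxy
    have hxy' : 0 < dist x y := dist_pos.2 hxy
    set E := η (dist x x₀ / dist x y) + η (dist x p / dist x y) + 1 with hE
    have e1 := hη_nn (dist x x₀ / dist x y) (by positivity)
    have e2 := hη_nn (dist x p / dist x y) (by positivity)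
    have hEp : 0 < E := by linarith
    refine ⟨c / E, by positivity, fun n => ?_⟩
    rw [div_le_iff₀ hEp]
    have h1 := hqs n x x₀ y hxy
    have h2 := hqs n x p y hxy
    have h3 := hθt n x₀ x p
    have h4 := hlow n
    have h5 := hθnn n x y
    rw [hθs n x₀ x] at h3
    simp only at h1 h2
    rw [hE]
    nlinarith
  -- equicontinuity
  let ω : X → X → ℝ := fun x y => η (dist x y / (dist x₀ p / 2)) * (M x + M x₀ + M p)
  have hω : ∀ n x y, θ n x y ≤ ω x y := by
    intro n x y
    have hv : ∃ v, dist x₀ p / 2 ≤ dist x v ∧ M v ≤ M x₀ + M p := by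
      by_cases h : dist x₀ p / 2 ≤ dist x x₀
      · exact ⟨x₀, h, by linarith [hMnn p]⟩
      · refine ⟨p, ?_, by linarith [hMnn x₀]⟩
        have := dist_triangle_left x₀ p x
        linarith
    obtain ⟨v, hv1, hv2⟩ := hv
    have hxv : x ≠ v := dist_pos.1 (by linarith)
    refine (hqs n x y v hxv).trans ?_
    refine mul_le_mul (hηm _ _ (by positivity) ?_) ?_ (hθnn _ _ _) (hη_nn _ (by positivity))
    · show dist x y / dist x v ≤ _
      gcongr
    · linarith [hM2 n x v]
  have hω0 : ∀ x, Tendsto (ω x) (𝓝 x) (𝓝 0) := by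
    intro x
    have h1 : Tendsto (fun y => dist x y / (dist x₀ p / 2)) (𝓝 x) (𝓝[Set.Ici 0] 0) := by
      refine tendsto_nhdsWithin_iff.2 ⟨?_, Eventually.of_forall fun y => ?_⟩
      · have : Continuous fun y => dist x y / (dist x₀ p / 2) := by fun_prop
        simpa using this.tendsto x
      · exact (by positivity : (0 : ℝ) ≤ dist x y / (dist x₀ p / 2))
    have h2 : Tendsto η (𝓝[Set.Ici 0] 0) (𝓝 0) := by
      have := hcont 0 Set.self_mem_Ici
      rwa [ContinuousWithinAt, hη0] at this
    have h3 := (h2.comp h1).mul_const (M x + M x₀ + M p)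
    rw [zero_mul] at h3
    exact h3
  obtain ⟨φ, g, hφ, hg⟩ := aux_ascoli (X × X) (fun n q => θ n q.1 q.2)
    (fun q => M q.1 + M q.2) (fun q r => ω q.1 r.1 + ω q.2 r.2)
    (fun n q => ⟨hθnn n _ _, hM2 n _ _⟩)
    (fun n q r => by
      have a1 := hθt n q.1 r.1 q.2
      have a2 := hθt n r.1 r.2 q.2
      have a3 := hθt n r.1 q.1 r.2
      have a4 := hθt n q.1 q.2 r.2
      have a5 := hω n q.1 r.1
      have a6 := hω n q.2 r.2
      rw [hθs n r.2 q.2] at a2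
      rw [hθs n r.1 q.1] at a3
      rw [abs_le]
      constructor <;> linarith)
    (fun q => by
      have b1 := ((hω0 q.1).comp (continuous_fst.tendsto q))
      have b2 := ((hω0 q.2).comp (continuous_snd.tendsto q))
      have b3 := b1.add b2
      rw [add_zero] at b3
      exact b3)
  have hpt : ∀ x y, Tendsto (fun k => θ (φ k) x y) atTop (𝓝 (g (x, y))) := fun x y =>
    (hg {(x, y)} isCompact_singleton).tendsto_at (Set.mem_singleton _)
  refine ⟨φ, fun x y => g (x, y), hφ, ⟨?_, ?_, ?_, ?_⟩, ?_, fun C hC => hg _ (hC.prod hC)⟩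
  · intro x y
    exact ge_of_tendsto' (hpt x y) fun k => hθnn _ _ _
  · intro x y
    constructor
    · intro h
      by_contra hxy
      obtain ⟨c', hc', hl⟩ := hlow2 x y hxy
      have := ge_of_tendsto' (hpt x y) fun k => hl (φ k)
      linarith
    · rintro rfl
      refine tendsto_nhds_unique (hpt x x) ?_
      simp only [hθ0]
      exact tendsto_const_nhds
  · intro x y
    refine tendsto_nhds_unique (hpt x y) ?_
    simp only [hθs _ x y]
    exact hpt y x
  · intro x y z
    exact le_of_tendsto_of_tendsto' (hpt x z) ((hpt x y).add (hpt y z)) fun k => hθt _ _ _ _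
  · intro x u v hxv
    exact le_of_tendsto_of_tendsto' (hpt x u) ((hpt x v).const_mul _) fun k => hqs _ x u v hxv
end
end
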